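/- arXiv:1511.07549 — 16 statements merged into one kernel-verified Lean document; each statement's English description precedes it below -/
import Mathlib

section
/- Let n ≥ 1, let B : Fin n → Fin n → ℝ∪{−∞} satisfy Tr(B) ≤ 0, let p : Fin n → ℝ∪{−∞} be nonzero, let q, h : Fin n → ℝ, and let g : Fin n → ℝ∪{−∞} satisfy (B*)_{ij} + g_j − h_i ≤ 0 for all i, j. Define the real number θ = max( (1/2)·max_{i,j}((B*)_{ij} + p_j − q_i), max_{i,j}((B*)_{ij} + p_j − h_i), max_{i,j}((B*)_{ij} + g_j − q_i) ). Then every vector x : Fin n → ℝ satisfying (for all i) max_j (B_{ij} + x_j) ≤ x_i, g_i ≤ x_i, and x_i ≤ h_i has objective value f(x) ≥ θ, and there exists such a vector x with f(x) = θ. -/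
open Finset

/-- Tropical (max-plus) matrix powers over `WithBot ℝ`:
`B⁰ = I` (diagonal `0`, off-diagonal `⊥`), and
`(B^(k+1)) i j = max over l of (B i l + (B^k) l j)`. -/
noncomputable def tropPow {n : ℕ} (B : Fin n → Fin n → WithBot ℝ) :
    ℕ → Fin n → Fin n → WithBot ℝ
  | 0 => fun i j => if i = j then (0 : WithBot ℝ) else ⊥
  | k + 1 => fun i j => Finset.univ.sup fun l => B i l + tropPow B k l j

/-- Kleene star: `(B*) i j = max over 0 ≤ k ≤ n-1 of (B^k) i j`. -/
noncomputable def tropStar {n : ℕ} (B : Fin n → Fin n → WithBot ℝ) (i j : Fin n) : WithBot ℝ :=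
  (Finset.range n).sup fun k => tropPow B k i j

/-- The objective `f(x) = max( max_j (p_j - x_j), max_i (x_i - q_i) )` in `WithBot ℝ`. -/
noncomputable def tropObj {n : ℕ} (p : Fin n → WithBot ℝ) (q x : Fin n → ℝ) : WithBot ℝ :=
  (Finset.univ.sup fun j => p j + ((-(x j) : ℝ) : WithBot ℝ)) ⊔
  (Finset.univ.sup fun i => ((x i - q i : ℝ) : WithBot ℝ))

lemma tropPow_add_le {n : ℕ} (B : Fin n → Fin n → WithBot ℝ) (a b : ℕ) (i l j : Fin n) :
    tropPow B a i l + tropPow B b l j ≤ tropPow B (a + b) i j := by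
  induction a generalizing i with
  | zero =>
    by_cases hil : i = l
    · subst hil; simp [tropPow]
    · simp [tropPow, hil]
  | succ a ih =>
    have hne : (Finset.univ : Finset (Fin n)).Nonempty := ⟨i, Finset.mem_univ _⟩
    obtain ⟨m, -, hm⟩ := Finset.exists_mem_eq_sup Finset.univ hne
      (fun m => B i m + tropPow B a m l)
    have h1 : tropPow B (a + 1) i l = B i m + tropPow B a m l := hm
    have h2 : B i m + tropPow B (a + b) m j ≤ tropPow B (a + b + 1) i j :=
      Finset.le_sup (f := fun m => B i m + tropPow B (a + b) m j) (Finset.mem_univ m)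
    rw [h1, add_assoc, show a + 1 + b = a + b + 1 by omega]
    exact le_trans (add_le_add le_rfl (ih m)) h2

lemma tropPow_one {n : ℕ} (B : Fin n → Fin n → WithBot ℝ) (i j : Fin n) :
    B i j ≤ tropPow B 1 i j := by
  have h2 : B i j + tropPow B 0 j j ≤ tropPow B 1 i j :=
    Finset.le_sup (f := fun m => B i m + tropPow B 0 m j) (Finset.mem_univ j)
  simpa [tropPow] using h2

lemma tropPow_walk {n : ℕ} (B : Fin n → Fin n → WithBot ℝ) (k : ℕ) (i j : Fin n)
    (hk : tropPow B k i j ≠ ⊥) : ∃ f : ℕ → Fin n, f 0 = i ∧ f k = j ∧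
      tropPow B k i j = ∑ t ∈ Finset.range k, B (f t) (f (t + 1)) := by
  induction k generalizing i with
  | zero =>
    by_cases hij : i = j
    · exact ⟨fun _ => i, rfl, hij, by simp [tropPow, hij]⟩
    · simp [tropPow, hij] at hk
  | succ k ih =>
    have hne : (Finset.univ : Finset (Fin n)).Nonempty := ⟨i, Finset.mem_univ _⟩
    obtain ⟨m, -, hm⟩ := Finset.exists_mem_eq_sup Finset.univ hne
      (fun m => B i m + tropPow B k m j)
    have h1 : tropPow B (k + 1) i j = B i m + tropPow B k m j := hm
    have h2 : tropPow B k m j ≠ ⊥ := by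
      intro h; rw [h1, h] at hk; simp at hk
    obtain ⟨f, f0, fk, hf⟩ := ih m h2
    refine ⟨fun t => Nat.casesOn t i f, rfl, fk, ?_⟩
    rw [Finset.sum_range_succ', h1, hf, add_comm]
    simp [f0]

lemma walk_le {n : ℕ} (B : Fin n → Fin n → WithBot ℝ) (f : ℕ → Fin n) (a k : ℕ) :
    ∑ t ∈ Finset.Ico a (a + k), B (f t) (f (t + 1)) ≤ tropPow B k (f a) (f (a + k)) := by
  induction k with
  | zero => simp [tropPow]
  | succ k ih =>
    rw [← add_assoc, Finset.sum_Ico_succ_top (by omega)]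
    exact le_trans (add_le_add ih (tropPow_one B _ _)) (tropPow_add_le B k 1 _ _ _)

lemma tropPow_le_star {n : ℕ} (B : Fin n → Fin n → WithBot ℝ)
    (hTr : ∀ i : Fin n, ∀ k : ℕ, 1 ≤ k → k ≤ n → tropPow B k i i ≤ 0)
    (k : ℕ) (hk : k ≤ n) (i j : Fin n) : tropPow B k i j ≤ tropStar B i j := by
  have key : ∀ k < n, tropPow B k i j ≤ tropStar B i j := fun k hk =>
    Finset.le_sup (f := fun k => tropPow B k i j) (Finset.mem_range.2 hk)
  rcases hk.lt_or_eq with hk | rfl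
  · exact key k hk
  by_cases hb : tropPow B k i j = ⊥
  · rw [hb]; exact bot_le
  obtain ⟨f, f0, fk, hf⟩ := tropPow_walk B k i j hb
  have hpig : ∃ a b : ℕ, a < b ∧ b ≤ k ∧ f a = f b := by
    obtain ⟨a, b, hab, he⟩ := Fintype.exists_ne_map_eq_of_card_lt
      (fun t : Fin (k + 1) => f t) (by simp)
    have hab' : (a : ℕ) ≠ b := fun h => hab (Fin.ext h)
    rcases lt_or_gt_of_ne hab' with h | h
    · exact ⟨a, b, h, by omega, he⟩
    · exact ⟨b, a, h, by omega, he.symm⟩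
  obtain ⟨a, b, hab, hbk, he⟩ := hpig
  have h1 := walk_le B f 0 a
  have h2 := walk_le B f a (b - a)
  have h3 := walk_le B f b (k - b)
  rw [show a + (b - a) = b by omega, ← he] at h2
  rw [show b + (k - b) = k by omega, ← he, fk] at h3
  rw [zero_add, f0] at h1
  have h4 := hTr (f a) (b - a) (by omega) (by omega)
  rw [hf, Finset.range_eq_Ico, ← Finset.sum_Ico_consecutive _ (Nat.zero_le a) (by omega : a ≤ k),
    ← Finset.sum_Ico_consecutive _ hab.le hbk]
  refine le_trans (add_le_add h1 (add_le_add (h2.trans h4) h3)) ?_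
  rw [zero_add]
  exact (tropPow_add_le B a (k - b) i (f a) j).trans (key _ (by omega))

lemma star_mul_le {n : ℕ} (B : Fin n → Fin n → WithBot ℝ)
    (hTr : ∀ i : Fin n, ∀ k : ℕ, 1 ≤ k → k ≤ n → tropPow B k i i ≤ 0)
    (i l j : Fin n) : tropStar B i l + B l j ≤ tropStar B i j := by
  have hne : (Finset.range n).Nonempty := ⟨i, Finset.mem_range.2 i.2⟩
  obtain ⟨k, hk, hm⟩ := Finset.exists_mem_eq_sup _ hne (fun k => tropPow B k i l)
  have h1 : tropStar B i l = tropPow B k i l := hm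
  rw [h1]
  refine le_trans (add_le_add le_rfl (tropPow_one B _ _)) ?_
  exact (tropPow_add_le B k 1 _ _ _).trans
    (tropPow_le_star B hTr _ (Finset.mem_range.1 hk) _ _)

lemma star_self {n : ℕ} (B : Fin n → Fin n → WithBot ℝ) (i : Fin n) : 0 ≤ tropStar B i i := by
  have h1 : tropPow B 0 i i ≤ tropStar B i i :=
    Finset.le_sup (f := fun k => tropPow B k i i) (Finset.mem_range.2 i.pos)
  have h2 : tropPow B 0 i i = 0 := by simp [tropPow]
  exact h2 ▸ h1

lemma tropPow_subsol {n : ℕ} (B : Fin n → Fin n → WithBot ℝ) (x : Fin n → ℝ)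
    (hx : ∀ i j, B i j + (x j : WithBot ℝ) ≤ (x i : WithBot ℝ)) (k : ℕ) (i j : Fin n) :
    tropPow B k i j + (x j : WithBot ℝ) ≤ (x i : WithBot ℝ) := by
  induction k generalizing i with
  | zero =>
    by_cases hij : i = j
    · subst hij; simp [tropPow]
    · simp [tropPow, hij]
  | succ k ih =>
    have hne : (Finset.univ : Finset (Fin n)).Nonempty := ⟨i, Finset.mem_univ _⟩
    obtain ⟨m, -, hm⟩ := Finset.exists_mem_eq_sup Finset.univ hne
      (fun m => B i m + tropPow B k m j)
    have h1 : tropPow B (k + 1) i j = B i m + tropPow B k m j := hm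
    rw [h1, add_assoc]
    exact le_trans (add_le_add le_rfl (ih m)) (hx i m)

lemma tropStar_subsol {n : ℕ} (B : Fin n → Fin n → WithBot ℝ) (x : Fin n → ℝ)
    (hx : ∀ i j, B i j + (x j : WithBot ℝ) ≤ (x i : WithBot ℝ)) (i j : Fin n) :
    tropStar B i j + (x j : WithBot ℝ) ≤ (x i : WithBot ℝ) := by
  have hne : (Finset.range n).Nonempty := ⟨i, Finset.mem_range.2 i.2⟩
  obtain ⟨k, hk, hm⟩ := Finset.exists_mem_eq_sup _ hne (fun k => tropPow B k i j)
  have h1 : tropStar B i j = tropPow B k i j := hm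
  rw [h1]
  exact tropPow_subsol B x hx k i j

lemma tropResidual {n : ℕ} (s : Fin n → WithBot ℝ) (c : Fin n → ℝ) (hs : ∃ k, s k ≠ ⊥) :
    ∃ x : ℝ, ∀ y : WithBot ℝ, y ≤ (x : WithBot ℝ) ↔ ∀ k, s k + y ≤ (c k : WithBot ℝ) := by
  classical
  obtain ⟨k0, hk0⟩ := hs
  have hne : (Finset.univ.filter fun k => s k ≠ ⊥).Nonempty := ⟨k0, by simpa using hk0⟩
  refine ⟨(Finset.univ.filter fun k => s k ≠ ⊥).inf' hne (fun k => c k - (s k).unbotD 0), ?_⟩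
  intro y
  induction y using WithBot.recBotCoe with
  | bot => simp
  | coe y =>
    rw [WithBot.coe_le_coe, Finset.le_inf'_iff]
    constructor
    · intro H k
      by_cases h2 : s k = ⊥
      · simp [h2]
      · have h1 := H k (by simpa using h2)
        obtain ⟨a, ha⟩ := WithBot.ne_bot_iff_exists.1 h2
        rw [← ha, WithBot.unbotD_coe] at h1
        rw [← ha, ← WithBot.coe_add, WithBot.coe_le_coe]; linarith
    · intro H k hk
      have h1 := H k
      have h2 : s k ≠ ⊥ := by simpa using hk
      obtain ⟨a, ha⟩ := WithBot.ne_bot_iff_exists.1 h2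
      rw [← ha, ← WithBot.coe_add, WithBot.coe_le_coe] at h1
      rw [← ha, WithBot.unbotD_coe]; linarith

theorem stmt0 {n : ℕ} (hn : 1 ≤ n) (B : Fin n → Fin n → WithBot ℝ)
    (hTr : ∀ i : Fin n, ∀ k : ℕ, 1 ≤ k → k ≤ n → tropPow B k i i ≤ 0)
    (p : Fin n → WithBot ℝ) (hp : ∃ i, p i ≠ ⊥)
    (q h : Fin n → ℝ) (g : Fin n → WithBot ℝ)
    (hgh : ∀ i j, tropStar B i j + g j + ((-(h i) : ℝ) : WithBot ℝ) ≤ 0)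
    (θ : ℝ)
    (hθ : (θ : WithBot ℝ) =
      (WithBot.map (fun r => r / 2)
        (Finset.univ.sup fun i => Finset.univ.sup fun j =>
          tropStar B i j + p j + ((-(q i) : ℝ) : WithBot ℝ))) ⊔
      (Finset.univ.sup fun i => Finset.univ.sup fun j =>
        tropStar B i j + p j + ((-(h i) : ℝ) : WithBot ℝ)) ⊔
      (Finset.univ.sup fun i => Finset.univ.sup fun j =>
        tropStar B i j + g j + ((-(q i) : ℝ) : WithBot ℝ))) :
    (∀ x : Fin n → ℝ,
      (∀ i, (Finset.univ.sup fun j => B i j + ((x j : ℝ) : WithBot ℝ)) ≤ ((x i : ℝ) : WithBot ℝ)) →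
      (∀ i, g i ≤ ((x i : ℝ) : WithBot ℝ)) →
      (∀ i, x i ≤ h i) →
      (θ : WithBot ℝ) ≤ tropObj p q x) ∧
    (∃ x : Fin n → ℝ,
      (∀ i, (Finset.univ.sup fun j => B i j + ((x j : ℝ) : WithBot ℝ)) ≤ ((x i : ℝ) : WithBot ℝ)) ∧
      (∀ i, g i ≤ ((x i : ℝ) : WithBot ℝ)) ∧
      (∀ i, x i ≤ h i) ∧
      tropObj p q x = (θ : WithBot ℝ)) := by
  have part1 : ∀ x : Fin n → ℝ,
      (∀ i, (Finset.univ.sup fun j => B i j + ((x j : ℝ) : WithBot ℝ)) ≤ ((x i : ℝ) : WithBot ℝ)) →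
      (∀ i, g i ≤ ((x i : ℝ) : WithBot ℝ)) →
      (∀ i, x i ≤ h i) →
      (θ : WithBot ℝ) ≤ tropObj p q x := by
    intro x hB hg hh
    have hB' : ∀ i j, B i j + (x j : WithBot ℝ) ≤ (x i : WithBot ℝ) := fun i j =>
      (Finset.le_sup (f := fun j => B i j + (x j : WithBot ℝ)) (Finset.mem_univ j)).trans (hB i)
    have hS := tropStar_subsol B x hB'
    have hP : ∀ j, p j + ((-(x j) : ℝ) : WithBot ℝ) ≤ tropObj p q x := fun j =>
      (Finset.le_sup (f := fun j => p j + ((-(x j) : ℝ) : WithBot ℝ))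
        (Finset.mem_univ j)).trans le_sup_left
    have hQ : ∀ j, ((x j - q j : ℝ) : WithBot ℝ) ≤ tropObj p q x := fun j =>
      (Finset.le_sup (f := fun j => ((x j - q j : ℝ) : WithBot ℝ))
        (Finset.mem_univ j)).trans le_sup_right
    have hnb : tropObj p q x ≠ ⊥ := by
      intro hb
      have := hQ ⟨0, hn⟩
      rw [hb] at this
      simp at this
    obtain ⟨r, hr⟩ := WithBot.ne_bot_iff_exists.1 hnb
    rw [← hr] at hP hQ ⊢
    have hQ' : ∀ j, x j - q j ≤ r := fun j => WithBot.coe_le_coe.1 (hQ j)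
    have hPS : ∀ i j, tropStar B i j + p j ≤ ((x i + r : ℝ) : WithBot ℝ) := by
      intro i j
      have h1 := hS i j
      have h2 := hP j
      revert h1 h2
      generalize tropStar B i j = a
      generalize p j = b
      intro h1 h2
      induction a using WithBot.recBotCoe with
      | bot => simp
      | coe a =>
        induction b using WithBot.recBotCoe with
        | bot => simp
        | coe b =>
          norm_cast at h1 h2 ⊢
          linarith
    have hGS : ∀ i j, tropStar B i j + g j ≤ (x i : WithBot ℝ) := fun i j =>
      (add_le_add le_rfl (hg j)).trans (hS i j)
    rw [hθ]
    refine sup_le (sup_le ?_ ?_) ?_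
    · have h1 : (Finset.univ.sup fun i => Finset.univ.sup fun j =>
          tropStar B i j + p j + ((-(q i) : ℝ) : WithBot ℝ)) ≤ ((2 * r : ℝ) : WithBot ℝ) := by
        refine Finset.sup_le fun i _ => Finset.sup_le fun j _ => ?_
        refine (add_le_add (hPS i j) le_rfl).trans ?_
        rw [← WithBot.coe_add, WithBot.coe_le_coe]
        linarith [hQ' i]
      have hm : Monotone (fun r : ℝ => r / 2) := fun a b hab => by
        change a / 2 ≤ b / 2
        linarith
      refine (hm.withBot_map h1).trans ?_
      rw [WithBot.map_coe, WithBot.coe_le_coe]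
      linarith
    · refine Finset.sup_le fun i _ => Finset.sup_le fun j _ => ?_
      refine (add_le_add (hPS i j) le_rfl).trans ?_
      rw [← WithBot.coe_add, WithBot.coe_le_coe]
      linarith [hh i]
    · refine Finset.sup_le fun i _ => Finset.sup_le fun j _ => ?_
      refine (add_le_add (hGS i j) le_rfl).trans ?_
      rw [← WithBot.coe_add, WithBot.coe_le_coe]
      linarith [hQ' i]
  refine ⟨part1, ?_⟩
  -- moving a real summand across an inequality
  have mv : ∀ (a : WithBot ℝ) (u v : ℝ), a + ((-u : ℝ) : WithBot ℝ) ≤ (v : WithBot ℝ) →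
      a ≤ ((v + u : ℝ) : WithBot ℝ) := by
    intro a u v H
    induction a using WithBot.recBotCoe with
    | bot => simp
    | coe a =>
      rw [← WithBot.coe_add, WithBot.coe_le_coe] at H
      rw [WithBot.coe_le_coe]
      linarith
  have dbl : ∀ (F : Fin n → Fin n → WithBot ℝ) (i j : Fin n),
      F i j ≤ Finset.univ.sup fun i => Finset.univ.sup fun j => F i j := fun F i j =>
    (Finset.le_sup (f := fun j => F i j) (Finset.mem_univ j)).trans
      (Finset.le_sup (f := fun i => Finset.univ.sup fun j => F i j) (Finset.mem_univ i))
  have e3 : ∀ i j, tropStar B i j + g j ≤ ((θ + q i : ℝ) : WithBot ℝ) := fun i j => by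
    apply mv
    rw [hθ]
    exact (dbl (fun i j => tropStar B i j + g j + ((-(q i) : ℝ) : WithBot ℝ)) i j).trans
      le_sup_right
  have e2 : ∀ i j, tropStar B i j + p j ≤ ((θ + h i : ℝ) : WithBot ℝ) := fun i j => by
    apply mv
    rw [hθ]
    exact (dbl (fun i j => tropStar B i j + p j + ((-(h i) : ℝ) : WithBot ℝ)) i j).trans
      (le_sup_right.trans le_sup_left)
  have e1 : ∀ i j, tropStar B i j + p j ≤ ((2 * θ + q i : ℝ) : WithBot ℝ) := fun i j => by
    apply mv
    refine (dbl (fun i j => tropStar B i j + p j + ((-(q i) : ℝ) : WithBot ℝ)) i j).trans ?_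
    have hle : WithBot.map (fun r : ℝ => r / 2)
        (Finset.univ.sup fun i => Finset.univ.sup fun j =>
          tropStar B i j + p j + ((-(q i) : ℝ) : WithBot ℝ)) ≤ (θ : WithBot ℝ) := by
      rw [hθ]
      exact le_sup_left.trans le_sup_left
    revert hle
    generalize (Finset.univ.sup fun i => Finset.univ.sup fun j =>
          tropStar B i j + p j + ((-(q i) : ℝ) : WithBot ℝ)) = a
    intro hle
    induction a using WithBot.recBotCoe with
    | bot => simp
    | coe a =>
      rw [WithBot.map_coe, WithBot.coe_le_coe] at hle
      rw [WithBot.coe_le_coe]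
      linarith
  have e0 : ∀ i j, tropStar B i j + g j ≤ (h i : WithBot ℝ) := fun i j => by
    have := mv _ (h i) 0 (by simpa using hgh i j)
    simpa using this
  have hres : ∀ i, ∃ x : ℝ, ∀ y : WithBot ℝ, y ≤ (x : WithBot ℝ) ↔
      ∀ k, tropStar B k i + y ≤ ((min (h k) (θ + q k) : ℝ) : WithBot ℝ) := fun i =>
    tropResidual (fun k => tropStar B k i) (fun k => min (h k) (θ + q k)) ⟨i, fun hb => by
      have := star_self B i
      rw [hb] at this
      simp at this⟩
  choose x hx using hres
  have hxx : ∀ k i, tropStar B k i + (x i : WithBot ℝ) ≤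
      ((min (h k) (θ + q k) : ℝ) : WithBot ℝ) := fun k i => (hx i (x i)).1 le_rfl k
  have hxc : ∀ i, x i ≤ min (h i) (θ + q i) := fun i => by
    have h1 := (add_le_add (star_self B i) (le_refl (x i : WithBot ℝ))).trans (hxx i i)
    rw [zero_add, WithBot.coe_le_coe] at h1
    exact h1
  have minle : ∀ (a : WithBot ℝ) (u v : ℝ), a ≤ (u : WithBot ℝ) → a ≤ (v : WithBot ℝ) →
      a ≤ ((min u v : ℝ) : WithBot ℝ) := by
    intro a u v h1 h2
    rcases min_choice u v with h | h <;> rw [h] <;> assumption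
  have c1 : ∀ i, (Finset.univ.sup fun j => B i j + ((x j : ℝ) : WithBot ℝ)) ≤
      ((x i : ℝ) : WithBot ℝ) := fun i => Finset.sup_le fun j _ => by
    rw [hx i]
    intro k
    rw [← add_assoc]
    exact (add_le_add (star_mul_le B hTr k i j) le_rfl).trans (hxx k j)
  have c2 : ∀ i, g i ≤ ((x i : ℝ) : WithBot ℝ) := fun i => by
    rw [hx i]
    exact fun k => minle _ _ _ (e0 k i) (e3 k i)
  have c3 : ∀ i, x i ≤ h i := fun i => (hxc i).trans (min_le_left _ _)
  refine ⟨x, c1, c2, c3, le_antisymm ?_ (part1 x c1 c2 c3)⟩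
  refine sup_le (Finset.sup_le fun j _ => ?_) (Finset.sup_le fun i _ => ?_)
  · have h1 : p j + ((-θ : ℝ) : WithBot ℝ) ≤ (x j : WithBot ℝ) := by
      rw [hx j]
      intro k
      rw [← add_assoc]
      apply minle
      · refine (add_le_add (e2 k j) le_rfl).trans ?_
        rw [← WithBot.coe_add, WithBot.coe_le_coe]
        linarith
      · refine (add_le_add (e1 k j) le_rfl).trans ?_
        rw [← WithBot.coe_add, WithBot.coe_le_coe]
        linarith
    refine (add_le_add (mv _ _ _ h1) le_rfl).trans ?_
    rw [← WithBot.coe_add, WithBot.coe_le_coe]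
    linarith
  · rw [WithBot.coe_le_coe]
    linarith [(hxc i).trans (min_le_right _ _)]
end

section
/- Let n ≥ 1, let B : Fin n → Fin n → ℝ∪{−∞} satisfy Tr(B) ≤ 0, let p : Fin n → ℝ∪{−∞} be nonzero, let q, h : Fin n → ℝ, and let g : Fin n → ℝ∪{−∞} satisfy (B*)_{ij} + g_j − h_i ≤ 0 for all i, j. Define θ = max( (1/2)·max_{i,j}((B*)_{ij} + p_j − q_i), max_{i,j}((B*)_{ij} + p_j − h_i), max_{i,j}((B*)_{ij} + g_j − q_i) ). Then a vector x : Fin n → ℝ satisfies the constraints (for all i: max_j (B_{ij} + x_j) ≤ x_i, g_i ≤ x_i, x_i ≤ h_i) and attains f(x) = θ if and only if there exists u : Fin n → ℝ such that for all i: g_i ≤ u_i, p_i − θ ≤ u_i, and for all j: (B*)_{ji} + u_i ≤ h_j and (B*)_{ji} + u_i ≤ q_j + θ, and x_i = max over j of ((B*)_{ij} + u_j) for all i. -/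
open Finset

theorem aux_pow_walk {n : ℕ} (B : Fin n → Fin n → WithBot ℝ) (k : ℕ) :
    ∀ i j, tropPow B k i j ≠ ⊥ → ∃ w : ℕ → Fin n, w 0 = i ∧ w k = j ∧
      tropPow B k i j = ∑ t ∈ Finset.range k, B (w t) (w (t + 1)) := by
  induction k with
  | zero =>
    intro i j hne
    by_cases hij : i = j
    · exact ⟨fun _ => i, rfl, hij, by simp [tropPow, hij]⟩
    · simp [tropPow, hij] at hne
  | succ k ih =>
    intro i j hne
    obtain ⟨l, -, hl⟩ := Finset.exists_mem_eq_sup (Finset.univ : Finset (Fin n)) ⟨i, mem_univ i⟩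
      (fun l => B i l + tropPow B k l j)
    have hl' : tropPow B (k + 1) i j = B i l + tropPow B k l j := hl
    have hne2 : tropPow B k l j ≠ ⊥ := by
      intro hb
      rw [hl', hb] at hne
      simp at hne
    obtain ⟨w, h0, hk, hs⟩ := ih l j hne2
    refine ⟨fun t => Nat.casesOn t i w, rfl, hk, ?_⟩
    rw [hl', hs, Finset.sum_range_succ', add_comm]
    simp [h0]

theorem aux_walk_le {n : ℕ} (B : Fin n → Fin n → WithBot ℝ) (k : ℕ) :
    ∀ w : ℕ → Fin n, ∑ t ∈ Finset.range k, B (w t) (w (t + 1)) ≤ tropPow B k (w 0) (w k) := by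
  induction k with
  | zero => intro w; simp [tropPow]
  | succ k ih =>
    intro w
    rw [Finset.sum_range_succ', add_comm]
    have h1 := ih (fun t => w (t + 1))
    refine (add_le_add_right h1 _).trans ?_
    exact Finset.le_sup (f := fun l => B (w 0) l + tropPow B k l (w (k + 1))) (mem_univ (w 1))

theorem aux_pow_add {n : ℕ} (B : Fin n → Fin n → WithBot ℝ) (a b : ℕ) :
    ∀ i l j, tropPow B a i l + tropPow B b l j ≤ tropPow B (a + b) i j := by
  induction a with
  | zero =>
    intro i l j
    by_cases hil : i = l
    · simp [tropPow, hil]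
    · simp [tropPow, hil]
  | succ a ih =>
    intro i l j
    obtain ⟨m, -, hm⟩ := Finset.exists_mem_eq_sup (Finset.univ : Finset (Fin n)) ⟨i, mem_univ i⟩
      (fun m => B i m + tropPow B a m l)
    have hm' : tropPow B (a + 1) i l = B i m + tropPow B a m l := hm
    rw [hm', add_assoc, show a + 1 + b = (a + b) + 1 by omega]
    refine (add_le_add_right (ih m l j) _).trans ?_
    exact Finset.le_sup (f := fun m => B i m + tropPow B (a + b) m j) (mem_univ m)

theorem aux_pow_n {n : ℕ} (B : Fin n → Fin n → WithBot ℝ)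
    (hTr : ∀ i : Fin n, ∀ k : ℕ, 1 ≤ k → k ≤ n → tropPow B k i i ≤ 0) (i j : Fin n) :
    tropPow B n i j ≤ tropStar B i j := by
  by_cases hb : tropPow B n i j = ⊥
  · rw [hb]; exact bot_le
  obtain ⟨w, h0, hk, hs⟩ := aux_pow_walk B n i j hb
  obtain ⟨s, t, hst, htn, hw⟩ : ∃ s t : ℕ, s < t ∧ t ≤ n ∧ w s = w t := by
    obtain ⟨a, b, hab, hw⟩ := Fintype.exists_ne_map_eq_of_card_lt
      (fun a : Fin (n + 1) => w a) (by simp)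
    rcases lt_or_gt_of_ne hab with hlt | hlt
    · exact ⟨a, b, hlt, by omega, hw⟩
    · exact ⟨b, a, hlt, by omega, hw.symm⟩
  obtain ⟨c, rfl⟩ := Nat.exists_eq_add_of_lt hst
  obtain ⟨d, hd⟩ := Nat.exists_eq_add_of_le htn
  have e : ∑ t ∈ Finset.range n, B (w t) (w (t + 1))
      = ∑ t ∈ Finset.range s, B (w t) (w (t + 1))
        + ∑ t ∈ Finset.range (c + 1), B (w (s + t)) (w (s + t + 1))
        + ∑ t ∈ Finset.range d, B (w (s + c + 1 + t)) (w (s + c + 1 + t + 1)) := by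
    have : Finset.range n = Finset.range ((s + (c + 1)) + d) := by congr 1
    rw [this, Finset.sum_range_add, Finset.sum_range_add]
    rfl
  have h1 := aux_walk_le B s w
  have h2 : _ ≤ tropPow B (c + 1) (w s) (w (s + c + 1)) :=
    aux_walk_le B (c + 1) (fun t => w (s + t))
  have h3 : _ ≤ tropPow B d (w (s + c + 1)) (w (s + c + 1 + d)) :=
    aux_walk_le B d (fun t => w (s + c + 1 + t))
  rw [← hw] at h2
  have h2' := h2.trans (hTr (w s) (c + 1) (by omega) (by omega))
  rw [← hw, ← hd, hk] at h3
  rw [h0] at h1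
  rw [hs, e]
  refine (add_le_add (add_le_add h1 h2') h3).trans ?_
  rw [add_zero]
  refine (aux_pow_add B s d i (w s) j).trans ?_
  exact Finset.le_sup (f := fun k => tropPow B k i j) (by simp; omega)

theorem aux_mul_star {n : ℕ} (hn : 1 ≤ n) (B : Fin n → Fin n → WithBot ℝ)
    (hTr : ∀ i : Fin n, ∀ k : ℕ, 1 ≤ k → k ≤ n → tropPow B k i i ≤ 0) (i l j : Fin n) :
    B i l + tropStar B l j ≤ tropStar B i j := by
  obtain ⟨k, hk, hs⟩ := Finset.exists_mem_eq_sup (Finset.range n) ⟨0, by simp; omega⟩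
    (fun k => tropPow B k l j)
  have hs' : tropStar B l j = tropPow B k l j := hs
  rw [hs']
  have h1 : B i l + tropPow B k l j ≤ tropPow B (k + 1) i j :=
    Finset.le_sup (f := fun m => B i m + tropPow B k m j) (mem_univ l)
  refine h1.trans ?_
  rw [Finset.mem_range] at hk
  rcases Nat.lt_or_ge (k + 1) n with hlt | hge
  · exact Finset.le_sup (f := fun k => tropPow B k i j) (by simpa using hlt)
  · rw [show k + 1 = n by omega]
    exact aux_pow_n B hTr i j

theorem aux_star_diag {n : ℕ} (hn : 1 ≤ n) (B : Fin n → Fin n → WithBot ℝ) (i : Fin n) :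
    0 ≤ tropStar B i i := by
  have : tropPow B 0 i i ≤ tropStar B i i :=
    Finset.le_sup (f := fun k => tropPow B k i i) (by simp; omega)
  simpa [tropPow] using this

theorem aux_star_sub {n : ℕ} (B : Fin n → Fin n → WithBot ℝ) (x : Fin n → ℝ)
    (hx : ∀ i, (Finset.univ.sup fun j => B i j + ((x j : ℝ) : WithBot ℝ)) ≤ ((x i : ℝ) : WithBot ℝ))
    (i j : Fin n) : tropStar B i j + ((x j : ℝ) : WithBot ℝ) ≤ ((x i : ℝ) : WithBot ℝ) := by
  have hx' : ∀ i j, B i j + ((x j : ℝ) : WithBot ℝ) ≤ ((x i : ℝ) : WithBot ℝ) := fun i j =>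
    (Finset.le_sup (f := fun j => B i j + ((x j : ℝ) : WithBot ℝ)) (mem_univ j)).trans (hx i)
  have key : ∀ k i j, tropPow B k i j + ((x j : ℝ) : WithBot ℝ) ≤ ((x i : ℝ) : WithBot ℝ) := by
    intro k
    induction k with
    | zero =>
      intro i j
      by_cases hij : i = j
      · simp [tropPow, hij]
      · simp [tropPow, hij]
    | succ k ih =>
      intro i j
      obtain ⟨m, -, hm⟩ := Finset.exists_mem_eq_sup (Finset.univ : Finset (Fin n)) ⟨i, mem_univ i⟩
        (fun m => B i m + tropPow B k m j)
      have hm' : tropPow B (k + 1) i j = B i m + tropPow B k m j := hm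
      rw [hm', add_assoc]
      exact (add_le_add_right (ih m j) _).trans (hx' i m)
  have hn : 0 < n := i.pos
  obtain ⟨k, hk, hs⟩ := Finset.exists_mem_eq_sup (Finset.range n) ⟨0, by simpa using hn⟩
    (fun k => tropPow B k i j)
  have hs' : tropStar B i j = tropPow B k i j := hs
  rw [hs']
  exact key k i j

theorem aux_shift (a : WithBot ℝ) (r c : ℝ) :
    a + ((-r : ℝ) : WithBot ℝ) ≤ (c : WithBot ℝ) ↔ a ≤ ((c + r : ℝ) : WithBot ℝ) := by
  induction a using WithBot.recBotCoe with
  | bot => simp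
  | coe a =>
    rw [← WithBot.coe_add, WithBot.coe_le_coe, WithBot.coe_le_coe]
    constructor <;> intro h <;> linarith

/-- From `p ≤ c + x_j` and `S + x_j ≤ x_i` get `S + p ≤ c + x_i`. -/
theorem aux_trans (S p : WithBot ℝ) (xj xi c : ℝ)
    (h1 : p ≤ ((c + xj : ℝ) : WithBot ℝ)) (h2 : S + (xj : WithBot ℝ) ≤ (xi : WithBot ℝ)) :
    S + p ≤ ((c + xi : ℝ) : WithBot ℝ) := by
  refine (add_le_add_right h1 S).trans ?_
  rw [WithBot.coe_add, WithBot.coe_add, add_left_comm]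
  exact add_le_add_right h2 _

theorem stmt1 {n : ℕ} (hn : 1 ≤ n) (B : Fin n → Fin n → WithBot ℝ)
    (hTr : ∀ i : Fin n, ∀ k : ℕ, 1 ≤ k → k ≤ n → tropPow B k i i ≤ 0)
    (p : Fin n → WithBot ℝ) (hp : ∃ i, p i ≠ ⊥)
    (q h : Fin n → ℝ) (g : Fin n → WithBot ℝ)
    (hgh : ∀ i j, tropStar B i j + g j + ((-(h i) : ℝ) : WithBot ℝ) ≤ 0)
    (θ : ℝ)
    (hθ : (θ : WithBot ℝ) =
      (WithBot.map (fun r => r / 2)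
        (Finset.univ.sup fun i => Finset.univ.sup fun j =>
          tropStar B i j + p j + ((-(q i) : ℝ) : WithBot ℝ))) ⊔
      (Finset.univ.sup fun i => Finset.univ.sup fun j =>
        tropStar B i j + p j + ((-(h i) : ℝ) : WithBot ℝ)) ⊔
      (Finset.univ.sup fun i => Finset.univ.sup fun j =>
        tropStar B i j + g j + ((-(q i) : ℝ) : WithBot ℝ))) :
    ∀ x : Fin n → ℝ,
      ((∀ i, (Finset.univ.sup fun j => B i j + ((x j : ℝ) : WithBot ℝ)) ≤ ((x i : ℝ) : WithBot ℝ)) ∧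
       (∀ i, g i ≤ ((x i : ℝ) : WithBot ℝ)) ∧
       (∀ i, x i ≤ h i) ∧
       tropObj p q x = (θ : WithBot ℝ))
      ↔
      (∃ u : Fin n → ℝ,
        (∀ i, g i ≤ ((u i : ℝ) : WithBot ℝ)) ∧
        (∀ i, p i + ((-θ : ℝ) : WithBot ℝ) ≤ ((u i : ℝ) : WithBot ℝ)) ∧
        (∀ i, ∀ j, tropStar B j i + ((u i : ℝ) : WithBot ℝ) ≤ ((h j : ℝ) : WithBot ℝ)) ∧
        (∀ i, ∀ j, tropStar B j i + ((u i : ℝ) : WithBot ℝ) ≤ ((q j + θ : ℝ) : WithBot ℝ)) ∧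
        (∀ i, ((x i : ℝ) : WithBot ℝ) =
          Finset.univ.sup fun j => tropStar B i j + ((u j : ℝ) : WithBot ℝ))) := by
  have hobj : ∀ (x : Fin n → ℝ) (c : ℝ), tropObj p q x ≤ (c : WithBot ℝ) ↔
      (∀ j, p j ≤ ((c + x j : ℝ) : WithBot ℝ)) ∧ ∀ i, x i ≤ c + q i := by
    intro x c
    unfold tropObj
    rw [sup_le_iff, Finset.sup_le_iff, Finset.sup_le_iff]
    simp only [aux_shift, mem_univ, true_imp_iff, WithBot.coe_le_coe, sub_le_iff_le_add]
  intro x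
  constructor
  · rintro ⟨hB, hg, hh, hf⟩
    obtain ⟨f1, f2⟩ := (hobj x θ).1 hf.le
    have hS := aux_star_sub B x hB
    refine ⟨x, hg, fun i => (aux_shift _ _ _).2 (by rw [add_comm]; exact f1 i),
      fun i j => (hS j i).trans (WithBot.coe_le_coe.2 (hh j)),
      fun i j => (hS j i).trans (WithBot.coe_le_coe.2 (by linarith [f2 j])), fun i => ?_⟩
    apply le_antisymm
    · refine le_trans ?_ (Finset.le_sup (f := fun j => tropStar B i j + ((x j : ℝ) : WithBot ℝ))
        (mem_univ i))
      have := add_le_add_left (aux_star_diag hn B i) ((x i : ℝ) : WithBot ℝ)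
      simpa using this
    · exact Finset.sup_le fun j _ => hS i j
  · rintro ⟨u, hg, hpu, hh, hq, hx⟩
    have hux : ∀ i, u i ≤ x i := by
      intro i
      rw [← WithBot.coe_le_coe, hx i]
      refine le_trans ?_ (Finset.le_sup (f := fun j => tropStar B i j + ((u j : ℝ) : WithBot ℝ))
        (mem_univ i))
      have := add_le_add_left (aux_star_diag hn B i) ((u i : ℝ) : WithBot ℝ)
      simpa using this
    have hB : ∀ i, (Finset.univ.sup fun j => B i j + ((x j : ℝ) : WithBot ℝ))
        ≤ ((x i : ℝ) : WithBot ℝ) := by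
      intro i
      refine Finset.sup_le fun j _ => ?_
      obtain ⟨m, -, hm⟩ := Finset.exists_mem_eq_sup (Finset.univ : Finset (Fin n)) ⟨i, mem_univ i⟩
        (fun m => tropStar B j m + ((u m : ℝ) : WithBot ℝ))
      rw [hx j, hm, hx i, ← add_assoc]
      refine (add_le_add_left (aux_mul_star hn B hTr i j m) _).trans ?_
      exact Finset.le_sup (f := fun j => tropStar B i j + ((u j : ℝ) : WithBot ℝ)) (mem_univ m)
    have hgx : ∀ i, g i ≤ ((x i : ℝ) : WithBot ℝ) := fun i =>
      (hg i).trans (WithBot.coe_le_coe.2 (hux i))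
    have hxh : ∀ i, x i ≤ h i := by
      intro i
      rw [← WithBot.coe_le_coe, hx i]
      exact Finset.sup_le fun j _ => hh j i
    have hle : tropObj p q x ≤ (θ : WithBot ℝ) := by
      rw [hobj]
      refine ⟨fun j => ((aux_shift _ _ _).1 (hpu j)).trans
        (WithBot.coe_le_coe.2 (by linarith [hux j])), fun i => ?_⟩
      rw [← WithBot.coe_le_coe, hx i, add_comm]
      exact Finset.sup_le fun j _ => hq j i
    refine ⟨hB, hgx, hxh, le_antisymm hle ?_⟩
    have hS := aux_star_sub B x hB
    obtain ⟨c, hc⟩ : ∃ c : ℝ, tropObj p q x = (c : WithBot ℝ) := by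
      have hne : tropObj p q x ≠ ⊥ := by
        intro hb
        have h1 : ((x ⟨0, hn⟩ - q ⟨0, hn⟩ : ℝ) : WithBot ℝ) ≤ tropObj p q x :=
          (Finset.le_sup (f := fun i => ((x i - q i : ℝ) : WithBot ℝ))
            (mem_univ (⟨0, hn⟩ : Fin n))).trans le_sup_right
        rw [hb] at h1
        simp at h1
      obtain ⟨c, hc⟩ := WithBot.ne_bot_iff_exists.1 hne
      exact ⟨c, hc.symm⟩
    obtain ⟨f1, f2⟩ := (hobj x c).1 hc.le
    rw [hc, hθ]
    refine sup_le (sup_le ?_ ?_) ?_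
    · have hA : (Finset.univ.sup fun i => Finset.univ.sup fun j =>
          tropStar B i j + p j + ((-(q i) : ℝ) : WithBot ℝ)) ≤ ((2 * c : ℝ) : WithBot ℝ) := by
        refine Finset.sup_le fun i _ => Finset.sup_le fun j _ => (aux_shift _ _ _).2 ?_
        refine (aux_trans _ _ _ _ _ (f1 j) (hS i j)).trans (WithBot.coe_le_coe.2 ?_)
        linarith [f2 i]
      revert hA
      generalize (Finset.univ.sup fun i => Finset.univ.sup fun j =>
          tropStar B i j + p j + ((-(q i) : ℝ) : WithBot ℝ)) = A
      intro hA
      induction A using WithBot.recBotCoe with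
      | bot => simp
      | coe a =>
        rw [WithBot.coe_le_coe] at hA
        rw [WithBot.map_coe, WithBot.coe_le_coe]
        linarith
    · refine Finset.sup_le fun i _ => Finset.sup_le fun j _ => (aux_shift _ _ _).2 ?_
      refine (aux_trans _ _ _ _ _ (f1 j) (hS i j)).trans (WithBot.coe_le_coe.2 ?_)
      linarith [hxh i]
    · refine Finset.sup_le fun i _ => Finset.sup_le fun j _ => (aux_shift _ _ _).2 ?_
      refine (aux_trans _ _ _ _ 0 (by simpa using hgx j) (hS i j)).trans
        (WithBot.coe_le_coe.2 ?_)
      linarith [f2 i]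
end

section
/- Let n ≥ 1, let p : Fin n → ℝ∪{−∞} be nonzero, let q, h : Fin n → ℝ, and let g : Fin n → ℝ∪{−∞} satisfy g_i ≤ h_i for all i. Define the real number θ = max( (1/2)·max_i (p_i − q_i), max_i (p_i − h_i), max_i (g_i − q_i) ). Then every vector x : Fin n → ℝ with g_i ≤ x_i ≤ h_i for all i has objective value f(x) ≥ θ, and there exists such a vector x with f(x) = θ. -/
open Finset

theorem stmt4 {n : ℕ} (hn : 1 ≤ n)
    (p : Fin n → WithBot ℝ) (hp : ∃ i, p i ≠ ⊥)
    (q h : Fin n → ℝ) (g : Fin n → WithBot ℝ)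
    (hgh : ∀ i, g i ≤ ((h i : ℝ) : WithBot ℝ))
    (θ : ℝ)
    (hθ : (θ : WithBot ℝ) =
      (WithBot.map (fun r => r / 2)
        (Finset.univ.sup fun i => p i + ((-(q i) : ℝ) : WithBot ℝ))) ⊔
      (Finset.univ.sup fun i => p i + ((-(h i) : ℝ) : WithBot ℝ)) ⊔
      (Finset.univ.sup fun i => g i + ((-(q i) : ℝ) : WithBot ℝ))) :
    (∀ x : Fin n → ℝ,
      (∀ i, g i ≤ ((x i : ℝ) : WithBot ℝ)) →
      (∀ i, x i ≤ h i) →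
      (θ : WithBot ℝ) ≤ tropObj p q x) ∧
    (∃ x : Fin n → ℝ,
      (∀ i, g i ≤ ((x i : ℝ) : WithBot ℝ)) ∧
      (∀ i, x i ≤ h i) ∧
      tropObj p q x = (θ : WithBot ℝ)) := by
  have hne : (Finset.univ : Finset (Fin n)).Nonempty := ⟨⟨0, hn⟩, Finset.mem_univ _⟩
  have hlow : ∀ x : Fin n → ℝ,
      (∀ i, g i ≤ ((x i : ℝ) : WithBot ℝ)) →
      (∀ i, x i ≤ h i) →
      (θ : WithBot ℝ) ≤ tropObj p q x := by
    intro x hg hx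
    have h1 : ∀ i, p i + ((-(x i) : ℝ) : WithBot ℝ) ≤ tropObj p q x := fun i =>
      le_sup_of_le_left (Finset.le_sup
        (f := fun j => p j + ((-(x j) : ℝ) : WithBot ℝ)) (Finset.mem_univ i))
    have h2 : ∀ i, ((x i - q i : ℝ) : WithBot ℝ) ≤ tropObj p q x := fun i =>
      le_sup_of_le_right (Finset.le_sup
        (f := fun j => ((x j - q j : ℝ) : WithBot ℝ)) (Finset.mem_univ i))
    rw [hθ]
    refine sup_le (sup_le ?_ (Finset.sup_le fun i _ => ?_)) (Finset.sup_le fun i _ => ?_)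
    · obtain ⟨i, -, hi⟩ := Finset.exists_mem_eq_sup Finset.univ hne
        (fun i => p i + ((-(q i) : ℝ) : WithBot ℝ))
      rw [hi]
      have a1 := h1 i
      have a2 := h2 i
      generalize tropObj p q x = t at a1 a2
      cases hpi : p i with
      | bot => simp
      | coe r =>
        cases t with
        | bot => simp at a2
        | coe t =>
          rw [hpi] at a1
          rw [← WithBot.coe_add, WithBot.coe_le_coe] at a1
          rw [WithBot.coe_le_coe] at a2
          rw [← WithBot.coe_add, WithBot.map_coe, WithBot.coe_le_coe]
          linarith
    · refine le_trans ?_ (h1 i)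
      gcongr
      exact WithBot.coe_le_coe.2 (neg_le_neg (hx i))
    · refine le_trans ?_ (h2 i)
      rw [sub_eq_add_neg, WithBot.coe_add]
      gcongr
      exact hg i
  refine ⟨hlow, ?_⟩
  have b1 : ∀ i, p i + ((-(q i) : ℝ) : WithBot ℝ) ≤ ((2 * θ : ℝ) : WithBot ℝ) := by
    intro i
    refine le_trans (Finset.le_sup
      (f := fun i => p i + ((-(q i) : ℝ) : WithBot ℝ)) (Finset.mem_univ i)) ?_
    have hh := le_sup_left.trans (le_sup_left.trans hθ.ge)
    generalize (Finset.univ.sup fun i => p i + ((-(q i) : ℝ) : WithBot ℝ)) = m at hh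
    cases m with
    | bot => simp
    | coe m =>
      rw [WithBot.map_coe, WithBot.coe_le_coe] at hh
      rw [WithBot.coe_le_coe]
      linarith
  have b2 : ∀ i, p i + ((-(h i) : ℝ) : WithBot ℝ) ≤ (θ : WithBot ℝ) := fun i =>
    (Finset.le_sup (f := fun i => p i + ((-(h i) : ℝ) : WithBot ℝ)) (Finset.mem_univ i)).trans
      (le_sup_right.trans (le_sup_left.trans hθ.ge))
  have b3 : ∀ i, g i + ((-(q i) : ℝ) : WithBot ℝ) ≤ (θ : WithBot ℝ) := fun i =>
    (Finset.le_sup (f := fun i => g i + ((-(q i) : ℝ) : WithBot ℝ)) (Finset.mem_univ i)).trans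
      (le_sup_right.trans hθ.ge)
  have hgx : ∀ i, g i ≤ ((min (h i) (q i + θ) : ℝ) : WithBot ℝ) := by
    intro i
    have c1 := hgh i
    have c2 := b3 i
    cases hgi : g i with
    | bot => simp
    | coe r =>
      rw [hgi, WithBot.coe_le_coe] at c1
      rw [hgi, ← WithBot.coe_add, WithBot.coe_le_coe] at c2
      rw [WithBot.coe_le_coe]
      exact le_min c1 (by linarith)
  refine ⟨fun i => min (h i) (q i + θ), hgx, fun i => min_le_left _ _, ?_⟩
  refine le_antisymm ?_ (hlow _ hgx fun i => min_le_left _ _)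
  refine sup_le (Finset.sup_le fun i _ => ?_) (Finset.sup_le fun i _ => ?_)
  · have c1 := b1 i
    have c2 := b2 i
    cases hpi : p i with
    | bot => simp
    | coe r =>
      rw [hpi, ← WithBot.coe_add, WithBot.coe_le_coe] at c1 c2
      rw [← WithBot.coe_add, WithBot.coe_le_coe]
      beta_reduce
      rcases min_choice (h i) (q i + θ) with e | e <;> rw [e] <;> linarith
  · rw [WithBot.coe_le_coe]
    have := min_le_right (h i) (q i + θ)
    linarith
end

section
/- Let n ≥ 1, let p : Fin n → ℝ∪{−∞} be nonzero, let q, h : Fin n → ℝ, and let g : Fin n → ℝ∪{−∞} satisfy g_i ≤ h_i for all i. Define θ = max( (1/2)·max_i (p_i − q_i), max_i (p_i − h_i), max_i (g_i − q_i) ). Then a vector x : Fin n → ℝ satisfies g_i ≤ x_i ≤ h_i for all i and attains f(x) = θ if and only if for every i: g_i ≤ x_i, p_i − θ ≤ x_i, and x_i ≤ min(h_i, q_i + θ). -/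
open Finset

lemma map_half_le (s : WithBot ℝ) (r : ℝ) (hs : s ≤ ((2 * r : ℝ) : WithBot ℝ)) :
    WithBot.map (fun r => r / 2) s ≤ (r : WithBot ℝ) := by
  induction s using WithBot.recBotCoe with
  | bot => simp
  | coe a =>
    rw [WithBot.map_coe]
    have := WithBot.coe_le_coe.1 hs
    exact WithBot.coe_le_coe.2 (by linarith)

lemma add_coe_le_iff (s : WithBot ℝ) (a b : ℝ) :
    s + (a : WithBot ℝ) ≤ (b : WithBot ℝ) ↔ s ≤ ((b - a : ℝ) : WithBot ℝ) := by
  induction s using WithBot.recBotCoe with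
  | bot => simp
  | coe c =>
    rw [← WithBot.coe_add, WithBot.coe_le_coe, WithBot.coe_le_coe]
    exact le_sub_iff_add_le.symm

lemma tropObj_le_iff {n : ℕ} (p : Fin n → WithBot ℝ) (q x : Fin n → ℝ) (r : ℝ) :
    tropObj p q x ≤ (r : WithBot ℝ) ↔
      (∀ i, p i ≤ ((r + x i : ℝ) : WithBot ℝ)) ∧ ∀ i, x i ≤ q i + r := by
  unfold tropObj
  rw [sup_le_iff, Finset.sup_le_iff, Finset.sup_le_iff]
  simp only [Finset.mem_univ, true_imp_iff, add_coe_le_iff, WithBot.coe_le_coe, sub_neg_eq_add,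
    sub_le_iff_le_add']

theorem stmt5 {n : ℕ} (hn : 1 ≤ n)
    (p : Fin n → WithBot ℝ) (hp : ∃ i, p i ≠ ⊥)
    (q h : Fin n → ℝ) (g : Fin n → WithBot ℝ)
    (hgh : ∀ i, g i ≤ ((h i : ℝ) : WithBot ℝ))
    (θ : ℝ)
    (hθ : (θ : WithBot ℝ) =
      (WithBot.map (fun r => r / 2)
        (Finset.univ.sup fun i => p i + ((-(q i) : ℝ) : WithBot ℝ))) ⊔
      (Finset.univ.sup fun i => p i + ((-(h i) : ℝ) : WithBot ℝ)) ⊔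
      (Finset.univ.sup fun i => g i + ((-(q i) : ℝ) : WithBot ℝ))) :
    ∀ x : Fin n → ℝ,
      ((∀ i, g i ≤ ((x i : ℝ) : WithBot ℝ)) ∧
       (∀ i, x i ≤ h i) ∧
       tropObj p q x = (θ : WithBot ℝ))
      ↔
      (∀ i, g i ≤ ((x i : ℝ) : WithBot ℝ) ∧
        p i + ((-θ : ℝ) : WithBot ℝ) ≤ ((x i : ℝ) : WithBot ℝ) ∧
        x i ≤ min (h i) (q i + θ)) := by
  intro x
  have key : (∀ i, g i ≤ ((x i : ℝ) : WithBot ℝ)) → (∀ i, x i ≤ h i) →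
      (θ : WithBot ℝ) ≤ tropObj p q x := by
    intro hg hh
    have hne : tropObj p q x ≠ ⊥ := by
      intro hb
      have h1 : ((x ⟨0, hn⟩ - q ⟨0, hn⟩ : ℝ) : WithBot ℝ) ≤ tropObj p q x :=
        le_sup_of_le_right (Finset.le_sup (f := fun i => ((x i - q i : ℝ) : WithBot ℝ))
          (Finset.mem_univ _))
      rw [hb] at h1
      exact WithBot.coe_ne_bot (le_bot_iff.1 h1)
    obtain ⟨r, hr⟩ := WithBot.ne_bot_iff_exists.1 hne
    obtain ⟨h1, h2⟩ := (tropObj_le_iff p q x r).1 hr.symm.le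
    rw [← hr, hθ]
    refine sup_le (sup_le (map_half_le _ _ ?_) ?_) ?_
    · refine Finset.sup_le fun i _ => (add_coe_le_iff _ _ _).2 ((h1 i).trans ?_)
      exact WithBot.coe_le_coe.2 (by linarith [h2 i])
    · refine Finset.sup_le fun i _ => (add_coe_le_iff _ _ _).2 ((h1 i).trans ?_)
      exact WithBot.coe_le_coe.2 (by linarith [hh i])
    · refine Finset.sup_le fun i _ => (add_coe_le_iff _ _ _).2 ((hg i).trans ?_)
      exact WithBot.coe_le_coe.2 (by linarith [h2 i])
  have e : ∀ i, x i - -θ = θ + x i := fun i => by ring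
  simp only [add_coe_le_iff, le_min_iff, e]
  constructor
  · rintro ⟨hg, hh, hf⟩ i
    obtain ⟨h1, h2⟩ := (tropObj_le_iff p q x θ).1 hf.le
    exact ⟨hg i, h1 i, hh i, h2 i⟩
  · intro H
    refine ⟨fun i => (H i).1, fun i => (H i).2.2.1, le_antisymm ?_ ?_⟩
    · exact (tropObj_le_iff p q x θ).2 ⟨fun i => (H i).2.1, fun i => (H i).2.2.2⟩
    · exact key (fun i => (H i).1) (fun i => (H i).2.2.1)
end

section
/- Let n ≥ 1, let p : Fin n → ℝ∪{−∞} be nonzero, and let q : Fin n → ℝ. Define the real number θ = (1/2)·max over i of (p_i − q_i). Then every vector x : Fin n → ℝ has objective value f(x) ≥ θ, and a vector x : Fin n → ℝ attains f(x) = θ if and only if for every i: p_i − θ ≤ x_i and x_i ≤ q_i + θ. -/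
open Finset

theorem stmt6 {n : ℕ} (hn : 1 ≤ n)
    (p : Fin n → WithBot ℝ) (hp : ∃ i, p i ≠ ⊥)
    (q : Fin n → ℝ)
    (θ : ℝ)
    (hθ : (θ : WithBot ℝ) =
      WithBot.map (fun r => r / 2)
        (Finset.univ.sup fun i => p i + ((-(q i) : ℝ) : WithBot ℝ))) :
    (∀ x : Fin n → ℝ, (θ : WithBot ℝ) ≤ tropObj p q x) ∧
    (∀ x : Fin n → ℝ,
      tropObj p q x = (θ : WithBot ℝ)
      ↔
      (∀ i, p i + ((-θ : ℝ) : WithBot ℝ) ≤ ((x i : ℝ) : WithBot ℝ) ∧ x i ≤ q i + θ)) := by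
  have hne : (Finset.univ : Finset (Fin n)).Nonempty := ⟨⟨0, hn⟩, Finset.mem_univ _⟩
  obtain ⟨k, -, hk⟩ := Finset.exists_mem_eq_sup Finset.univ hne
    (fun i => p i + ((-(q i) : ℝ) : WithBot ℝ))
  rw [hk] at hθ
  obtain ⟨a, ha, hθa⟩ : ∃ a : ℝ, p k = (a : WithBot ℝ) ∧ θ = (a + -q k) / 2 := by
    cases h : p k with
    | bot =>
      simp [h] at hθ
    | coe a =>
      refine ⟨a, rfl, ?_⟩
      simp only [h] at hθ
      rw [← WithBot.coe_add, WithBot.map_coe] at hθ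
      exact WithBot.coe_injective hθ
  have lower : ∀ x : Fin n → ℝ, (θ : WithBot ℝ) ≤ tropObj p q x := by
    intro x
    unfold tropObj
    rcases le_total θ (x k - q k) with h | h
    · refine le_trans ?_ le_sup_right
      exact le_trans (WithBot.coe_le_coe.2 h)
        (Finset.le_sup (f := fun i => ((x i - q i : ℝ) : WithBot ℝ)) (Finset.mem_univ k))
    · refine le_trans ?_ le_sup_left
      refine le_trans ?_ (Finset.le_sup
        (f := fun j => p j + ((-(x j) : ℝ) : WithBot ℝ)) (Finset.mem_univ k))
      simp only [ha]
      rw [← WithBot.coe_add, WithBot.coe_le_coe]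
      linarith
  refine ⟨lower, fun x => ?_⟩
  have key : tropObj p q x = (θ : WithBot ℝ) ↔ tropObj p q x ≤ (θ : WithBot ℝ) :=
    ⟨fun h => h.le, fun h => le_antisymm h (lower x)⟩
  rw [key]
  unfold tropObj
  rw [sup_le_iff, Finset.sup_le_iff, Finset.sup_le_iff, forall_and]
  refine and_congr ?_ ?_
  · simp only [Finset.mem_univ, true_imp_iff]
    refine forall_congr' fun i => ?_
    cases p i with
    | bot => simp
    | coe b =>
      rw [← WithBot.coe_add, ← WithBot.coe_add, WithBot.coe_le_coe, WithBot.coe_le_coe]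
      constructor <;> intro h <;> linarith
  · simp only [Finset.mem_univ, true_imp_iff]
    refine forall_congr' fun i => ?_
    rw [WithBot.coe_le_coe]
    constructor <;> intro h <;> linarith
end

section
/- For all real numbers x1, x2, setting y1 = x1 + x2 and y2 = x2 − x1, one has max over j = 1,…,m of ( w_j + |x1 − r_{1j}| + |x2 − r_{2j}| ) = max( p1 − y1, y1 − q1, p2 − y2, y2 − q2 ). -/
theorem stmt8 (m : ℕ) (hm : 1 ≤ m)
    (hne : (Finset.univ : Finset (Fin m)).Nonempty)
    (r1 r2 w : Fin m → ℝ)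
    (p1 p2 q1 q2 : ℝ)
    (hp1 : p1 = Finset.univ.sup' hne fun j => w j + r1 j + r2 j)
    (hp2 : p2 = Finset.univ.sup' hne fun j => w j - r1 j + r2 j)
    (hq1 : q1 = Finset.univ.inf' hne fun j => -w j + r1 j + r2 j)
    (hq2 : q2 = Finset.univ.inf' hne fun j => -w j - r1 j + r2 j)
    (x1 x2 y1 y2 : ℝ) (hy1 : y1 = x1 + x2) (hy2 : y2 = x2 - x1) :
    (Finset.univ.sup' hne fun j => w j + |x1 - r1 j| + |x2 - r2 j|) =
      max (max (p1 - y1) (y1 - q1)) (max (p2 - y2) (y2 - q2)) := by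
  have P1 : ∀ j, w j + r1 j + r2 j ≤ p1 := fun j => by
    rw [hp1]; exact Finset.le_sup' (fun j => w j + r1 j + r2 j) (Finset.mem_univ j)
  have P2 : ∀ j, w j - r1 j + r2 j ≤ p2 := fun j => by
    rw [hp2]; exact Finset.le_sup' (fun j => w j - r1 j + r2 j) (Finset.mem_univ j)
  have Q1 : ∀ j, q1 ≤ -w j + r1 j + r2 j := fun j => by
    rw [hq1]; exact Finset.inf'_le (fun j => -w j + r1 j + r2 j) (Finset.mem_univ j)
  have Q2 : ∀ j, q2 ≤ -w j - r1 j + r2 j := fun j => by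
    rw [hq2]; exact Finset.inf'_le (fun j => -w j - r1 j + r2 j) (Finset.mem_univ j)
  have S : ∀ j, w j + |x1 - r1 j| + |x2 - r2 j| ≤
      Finset.univ.sup' hne fun j => w j + |x1 - r1 j| + |x2 - r2 j| := fun j =>
    Finset.le_sup' (fun j => w j + |x1 - r1 j| + |x2 - r2 j|) (Finset.mem_univ j)
  apply le_antisymm
  · apply Finset.sup'_le
    intro j _
    have a1 := P1 j
    have a2 := P2 j
    have a3 := Q1 j
    have a4 := Q2 j
    simp only [le_max_iff]
    rcases abs_cases (x1 - r1 j) with ⟨h1, _⟩ | ⟨h1, _⟩ <;>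
      rcases abs_cases (x2 - r2 j) with ⟨h2, _⟩ | ⟨h2, _⟩ <;> rw [h1, h2]
    · left; right; linarith
    · right; left; linarith
    · right; right; linarith
    · left; left; linarith
  · obtain ⟨j1, _, e1⟩ := Finset.exists_mem_eq_sup' hne fun j => w j + r1 j + r2 j
    obtain ⟨j2, _, e2⟩ := Finset.exists_mem_eq_sup' hne fun j => w j - r1 j + r2 j
    obtain ⟨j3, _, e3⟩ := Finset.exists_mem_eq_inf' hne fun j => -w j + r1 j + r2 j
    obtain ⟨j4, _, e4⟩ := Finset.exists_mem_eq_inf' hne fun j => -w j - r1 j + r2 j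
    refine max_le (max_le ?_ ?_) (max_le ?_ ?_)
    · linarith [S j1, neg_abs_le (x1 - r1 j1), neg_abs_le (x2 - r2 j1)]
    · linarith [S j3, le_abs_self (x1 - r1 j3), le_abs_self (x2 - r2 j3)]
    · linarith [S j2, le_abs_self (x1 - r1 j2), neg_abs_le (x2 - r2 j2)]
    · linarith [S j4, neg_abs_le (x1 - r1 j4), le_abs_self (x2 - r2 j4)]
end

section
/- For all real numbers x1, x2, setting y1 = x1 + x2 and y2 = x2 − x1, the following are equivalent: (i) |x1 − r_{1j}| + |x2 − r_{2j}| ≤ d_j for every j = 1,…,m; (ii) g1 ≤ y1 ≤ h1 and g2 ≤ y2 ≤ h2. -/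
theorem stmt9 (m : ℕ) (hm : 1 ≤ m)
    (hne : (Finset.univ : Finset (Fin m)).Nonempty)
    (r1 r2 d : Fin m → ℝ) (hd : ∀ j, 0 ≤ d j)
    (g1 g2 h1 h2 : ℝ)
    (hg1 : g1 = Finset.univ.sup' hne fun j => -d j + r1 j + r2 j)
    (hg2 : g2 = Finset.univ.sup' hne fun j => -d j - r1 j + r2 j)
    (hh1 : h1 = Finset.univ.inf' hne fun j => d j + r1 j + r2 j)
    (hh2 : h2 = Finset.univ.inf' hne fun j => d j - r1 j + r2 j)
    (x1 x2 y1 y2 : ℝ) (hy1 : y1 = x1 + x2) (hy2 : y2 = x2 - x1) :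
    (∀ j, |x1 - r1 j| + |x2 - r2 j| ≤ d j) ↔
      ((g1 ≤ y1 ∧ y1 ≤ h1) ∧ (g2 ≤ y2 ∧ y2 ≤ h2)) := by
  subst hg1 hg2 hh1 hh2 hy1 hy2
  simp only [Finset.sup'_le_iff, Finset.le_inf'_iff, Finset.mem_univ, true_implies]
  constructor
  · intro h
    refine ⟨⟨fun j => ?_, fun j => ?_⟩, ⟨fun j => ?_, fun j => ?_⟩⟩ <;>
    · have := h j
      have a1 := le_abs_self (x1 - r1 j)
      have a2 := neg_abs_le (x1 - r1 j)
      have a3 := le_abs_self (x2 - r2 j)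
      have a4 := neg_abs_le (x2 - r2 j)
      linarith
  · rintro ⟨⟨h1, h2⟩, ⟨h3, h4⟩⟩ j
    have b1 := h1 j
    have b2 := h2 j
    have b3 := h3 j
    have b4 := h4 j
    rcases abs_cases (x1 - r1 j) with ⟨e, _⟩ | ⟨e, _⟩ <;>
    rcases abs_cases (x2 - r2 j) with ⟨f, _⟩ | ⟨f, _⟩ <;>
    · rw [e, f]
      linarith
end

section
/- Assume max( g1 − h1, g1 − h2 − 2t, g2 − h1 + 2s, g2 − h2 ) ≤ 0, and define θ = max( (p1−q1)/2, (p1−q2)/2 − t, (p2−q1)/2 + s, (p2−q2)/2, p1 − h1, p1 − h2 − 2t, p2 − h1 + 2s, p2 − h2, g1 − q1, g1 − q2 − 2t, g2 − q1 + 2s, g2 − q2 ). Then every (x1, x2) ∈ ℝ² satisfying |x1 − r_{1j}| + |x2 − r_{2j}| ≤ d_j for all j = 1,…,m and s ≤ x1 ≤ t has max over j of ( w_j + |x1 − r_{1j}| + |x2 − r_{2j}| ) ≥ θ, and there exists such a feasible point (x1, x2) for which this maximum equals θ. -/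
theorem stmt10 (m : ℕ) (hm : 1 ≤ m)
    (hne : (Finset.univ : Finset (Fin m)).Nonempty)
    (r1 r2 w d : Fin m → ℝ) (hd : ∀ j, 0 ≤ d j)
    (s t : ℝ) (hst : s ≤ t)
    (p1 p2 q1 q2 g1 g2 h1 h2 : ℝ)
    (hp1 : p1 = Finset.univ.sup' hne fun j => w j + r1 j + r2 j)
    (hp2 : p2 = Finset.univ.sup' hne fun j => w j - r1 j + r2 j)
    (hq1 : q1 = Finset.univ.inf' hne fun j => -w j + r1 j + r2 j)
    (hq2 : q2 = Finset.univ.inf' hne fun j => -w j - r1 j + r2 j)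
    (hg1 : g1 = Finset.univ.sup' hne fun j => -d j + r1 j + r2 j)
    (hg2 : g2 = Finset.univ.sup' hne fun j => -d j - r1 j + r2 j)
    (hh1 : h1 = Finset.univ.inf' hne fun j => d j + r1 j + r2 j)
    (hh2 : h2 = Finset.univ.inf' hne fun j => d j - r1 j + r2 j)
    (hfeas : max (max (g1 - h1) (g1 - h2 - 2 * t)) (max (g2 - h1 + 2 * s) (g2 - h2)) ≤ 0)
    (θ : ℝ)
    (hθ : θ = max
      (max (max ((p1 - q1) / 2) ((p1 - q2) / 2 - t)) (max ((p2 - q1) / 2 + s) ((p2 - q2) / 2)))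
      (max
        (max (max (p1 - h1) (p1 - h2 - 2 * t)) (max (p2 - h1 + 2 * s) (p2 - h2)))
        (max (max (g1 - q1) (g1 - q2 - 2 * t)) (max (g2 - q1 + 2 * s) (g2 - q2))))) :
    (∀ x1 x2 : ℝ,
      (∀ j, |x1 - r1 j| + |x2 - r2 j| ≤ d j) → s ≤ x1 → x1 ≤ t →
      θ ≤ Finset.univ.sup' hne fun j => w j + |x1 - r1 j| + |x2 - r2 j|) ∧
    (∃ x1 x2 : ℝ,
      (∀ j, |x1 - r1 j| + |x2 - r2 j| ≤ d j) ∧ s ≤ x1 ∧ x1 ≤ t ∧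
      (Finset.univ.sup' hne fun j => w j + |x1 - r1 j| + |x2 - r2 j|) = θ) := by
  have hp1' : ∀ c, p1 ≤ c ↔ ∀ j, w j + r1 j + r2 j ≤ c := by intro c; simp [hp1]
  have hp2' : ∀ c, p2 ≤ c ↔ ∀ j, w j - r1 j + r2 j ≤ c := by intro c; simp [hp2]
  have hg1' : ∀ c, g1 ≤ c ↔ ∀ j, -d j + r1 j + r2 j ≤ c := by intro c; simp [hg1]
  have hg2' : ∀ c, g2 ≤ c ↔ ∀ j, -d j - r1 j + r2 j ≤ c := by intro c; simp [hg2]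
  have hq1' : ∀ c, c ≤ q1 ↔ ∀ j, c ≤ -w j + r1 j + r2 j := by intro c; simp [hq1]
  have hq2' : ∀ c, c ≤ q2 ↔ ∀ j, c ≤ -w j - r1 j + r2 j := by intro c; simp [hq2]
  have hh1' : ∀ c, c ≤ h1 ↔ ∀ j, c ≤ d j + r1 j + r2 j := by intro c; simp [hh1]
  have hh2' : ∀ c, c ≤ h2 ↔ ∀ j, c ≤ d j - r1 j + r2 j := by intro c; simp [hh2]
  clear hp1 hp2 hq1 hq2 hg1 hg2 hh1 hh2
  have habs : ∀ x y c : ℝ, |x| + |y| ≤ c ↔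
      x + y ≤ c ∧ x - y ≤ c ∧ -x + y ≤ c ∧ -x - y ≤ c := by
    intro x y c
    constructor
    · intro h
      have := le_abs_self x
      have := neg_abs_le x
      have := le_abs_self y
      have := neg_abs_le y
      refine ⟨?_, ?_, ?_, ?_⟩ <;> linarith
    · rintro ⟨_, _, _, _⟩
      rcases abs_cases x with ⟨e, _⟩ | ⟨e, _⟩ <;> rcases abs_cases y with ⟨e', _⟩ | ⟨e', _⟩ <;>
        rw [e, e'] <;> linarith
  have hM : ∀ x1 x2 c : ℝ, (Finset.univ.sup' hne fun j => w j + |x1 - r1 j| + |x2 - r2 j|) ≤ c ↔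
      ∀ j, |x1 - r1 j| + |x2 - r2 j| ≤ c - w j := by
    intro x1 x2 c
    simp only [Finset.sup'_le_iff, Finset.mem_univ, true_implies]
    refine forall_congr' fun j => ⟨fun h => by linarith, fun h => by linarith⟩
  have lower : ∀ x1 x2 : ℝ,
      (∀ j, |x1 - r1 j| + |x2 - r2 j| ≤ d j) → s ≤ x1 → x1 ≤ t →
      θ ≤ Finset.univ.sup' hne fun j => w j + |x1 - r1 j| + |x2 - r2 j| := by
    intro x1 x2 hx hs ht
    have hS := (hM x1 x2 _).1 le_rfl
    generalize (Finset.univ.sup' hne fun j => w j + |x1 - r1 j| + |x2 - r2 j|) = M at hS ⊢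
    simp only [habs] at hS hx
    have a1 := (hp1' (x1 + x2 + M)).2 fun j => by linarith [(hS j).2.2.2]
    have a2 := (hp2' (x2 - x1 + M)).2 fun j => by linarith [(hS j).2.1]
    have a3 := (hq1' (x1 + x2 - M)).2 fun j => by linarith [(hS j).1]
    have a4 := (hq2' (x2 - x1 - M)).2 fun j => by linarith [(hS j).2.2.1]
    have b1 := (hg1' (x1 + x2)).2 fun j => by linarith [(hx j).2.2.2]
    have b2 := (hg2' (x2 - x1)).2 fun j => by linarith [(hx j).2.1]
    have b3 := (hh1' (x1 + x2)).2 fun j => by linarith [(hx j).1]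
    have b4 := (hh2' (x2 - x1)).2 fun j => by linarith [(hx j).2.2.1]
    rw [hθ]
    simp only [max_le_iff]
    refine ⟨⟨⟨?_, ?_⟩, ?_, ?_⟩, ⟨⟨?_, ?_⟩, ?_, ?_⟩, ⟨?_, ?_⟩, ?_, ?_⟩ <;> linarith
  refine ⟨lower, ?_⟩
  have key : ∀ a b c e : ℝ, a ≤ b → c ≤ e → a - e ≤ 2 * t → c - b + 2 * s ≤ 0 →
      ∃ u v : ℝ, a ≤ u ∧ u ≤ b ∧ c ≤ v ∧ v ≤ e ∧ 2 * s ≤ u - v ∧ u - v ≤ 2 * t := by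
    intro a b c e h1 h2 h3 h4
    obtain ⟨v, hv⟩ : ∃ v, v = max c (a - 2 * t) := ⟨_, rfl⟩
    have v1 : c ≤ v := hv ▸ le_max_left _ _
    have v2 : a - 2 * t ≤ v := hv ▸ le_max_right _ _
    have v3 : v ≤ e := hv ▸ max_le h2 (by linarith)
    have v4 : v ≤ b - 2 * s := hv ▸ max_le (by linarith) (by linarith)
    refine ⟨max a (v + 2 * s), v, le_max_left _ _, max_le h1 (by linarith), v1, v3, ?_, ?_⟩
    · linarith [le_max_right a (v + 2 * s)]
    · have : max a (v + 2 * s) ≤ v + 2 * t := max_le (by linarith) (by linarith)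
      linarith
  have hθ' := hθ.ge
  simp only [max_le_iff] at hθ' hfeas
  obtain ⟨⟨⟨_, _⟩, _, _⟩, ⟨⟨_, _⟩, _, _⟩, ⟨_, _⟩, _, _⟩ := hθ'
  obtain ⟨⟨_, _⟩, _, _⟩ := hfeas
  obtain ⟨u, v, u1, u2, v1, v2, c1, c2⟩ := key (max g1 (p1 - θ)) (min h1 (q1 + θ))
    (max g2 (p2 - θ)) (min h2 (q2 + θ))
    (by refine max_le (le_min ?_ ?_) (le_min ?_ ?_) <;> linarith)
    (by refine max_le (le_min ?_ ?_) (le_min ?_ ?_) <;> linarith)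
    (by
      rw [sub_le_iff_le_add', ← sub_le_iff_le_add]
      refine le_min ?_ ?_ <;> rw [sub_le_iff_le_add] <;> refine max_le ?_ ?_ <;> linarith)
    (by
      have : max g2 (p2 - θ) ≤ min h1 (q1 + θ) - 2 * s := by
        rw [le_sub_iff_add_le]
        refine le_min ?_ ?_ <;> rw [← le_sub_iff_add_le] <;> refine max_le ?_ ?_ <;> linarith
      linarith)
  simp only [max_le_iff, le_min_iff] at u1 u2 v1 v2
  have a1 := (hp1' (u + θ)).1 (by linarith)
  have a2 := (hp2' (v + θ)).1 (by linarith)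
  have a3 := (hq1' (u - θ)).1 (by linarith)
  have a4 := (hq2' (v - θ)).1 (by linarith)
  have b1 := (hg1' u).1 u1.1
  have b2 := (hg2' v).1 v1.1
  have b3 := (hh1' u).1 u2.1
  have b4 := (hh2' v).1 v2.1
  have hx : ∀ j, |(u - v) / 2 - r1 j| + |(u + v) / 2 - r2 j| ≤ d j := by
    intro j
    have := b1 j
    have := b2 j
    have := b3 j
    have := b4 j
    rw [habs]
    refine ⟨?_, ?_, ?_, ?_⟩ <;> linarith
  refine ⟨(u - v) / 2, (u + v) / 2, hx, by linarith, by linarith, le_antisymm ?_ ?_⟩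
  · rw [hM]
    intro j
    have := a1 j
    have := a2 j
    have := a3 j
    have := a4 j
    rw [habs]
    refine ⟨?_, ?_, ?_, ?_⟩ <;> linarith
  · exact lower _ _ hx (by linarith) (by linarith)
end

section
/- Assume max( g1 − h1, g1 − h2 − 2t, g2 − h1 + 2s, g2 − h2 ) ≤ 0, and define θ = max( (p1−q1)/2, (p1−q2)/2 − t, (p2−q1)/2 + s, (p2−q2)/2, p1 − h1, p1 − h2 − 2t, p2 − h1 + 2s, p2 − h2, g1 − q1, g1 − q2 − 2t, g2 − q1 + 2s, g2 − q2 ). Then a point (x1, x2) ∈ ℝ² satisfies the constraints (|x1 − r_{1j}| + |x2 − r_{2j}| ≤ d_j for all j, and s ≤ x1 ≤ t) and attains max_j ( w_j + |x1 − r_{1j}| + |x2 − r_{2j}| ) = θ if and only if there exists α ∈ [0,1] such that, with u1 = (1−α)·max(g1, p1 − θ) + α·min(h1, q1 + θ, h2 + 2t, q2 + 2t + θ) and u2 = (1−α)·max(g2, p2 − θ) + α·min(h1 − 2s, q1 − 2s + θ, h2, q2 + θ), one has x1 = ( max(u1, u2 + 2s) − max(u1 − 2t, u2) ) / 2 and x2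 = ( max(u1, u2 + 2s) + max(u1 − 2t, u2) ) / 2. -/
theorem seg_bounds (L U α : ℝ) (h : L ≤ U) (h0 : 0 ≤ α) (h1 : α ≤ 1) :
    L ≤ (1 - α) * L + α * U ∧ (1 - α) * L + α * U ≤ U := by
  constructor <;> nlinarith

theorem abs_add_abs_le_iff' (a b c : ℝ) :
    |a| + |b| ≤ c ↔ a + b ≤ c ∧ -a - b ≤ c ∧ b - a ≤ c ∧ a - b ≤ c := by
  constructor
  · intro h
    have := le_abs_self a
    have := neg_le_abs a
    have := le_abs_self b
    have := neg_le_abs b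
    refine ⟨?_, ?_, ?_, ?_⟩ <;> linarith
  · rintro ⟨h1, h2, h3, h4⟩
    rcases abs_cases a with ⟨h, _⟩ | ⟨h, _⟩ <;> rcases abs_cases b with ⟨h', _⟩ | ⟨h', _⟩ <;>
      rw [h, h'] <;> linarith

theorem exists_param (L1 U1 L2 U2 y1 y2 : ℝ) (h : L1 = U1 ∨ L2 = U2)
    (a1 : L1 ≤ y1) (b1 : y1 ≤ U1) (a2 : L2 ≤ y2) (b2 : y2 ≤ U2) :
    ∃ α : ℝ, 0 ≤ α ∧ α ≤ 1 ∧ (1 - α) * L1 + α * U1 = y1 ∧ (1 - α) * L2 + α * U2 = y2 := by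
  have seg : ∀ L U y : ℝ, L ≤ y → y ≤ U → ∃ α : ℝ, 0 ≤ α ∧ α ≤ 1 ∧ (1 - α) * L + α * U = y := by
    intro L U y hL hU
    rcases eq_or_lt_of_le (hL.trans hU) with e | e
    · exact ⟨0, le_rfl, zero_le_one, by linarith⟩
    · have hp : 0 < U - L := sub_pos.2 e
      refine ⟨(y - L) / (U - L), div_nonneg (by linarith) hp.le, ?_, ?_⟩
      · rw [div_le_one hp]; linarith
      · field_simp
        ring
  rcases h with h | h
  · obtain ⟨α, h0, h1, e⟩ := seg L2 U2 y2 a2 b2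
    refine ⟨α, h0, h1, ?_, e⟩
    have : y1 = L1 := by linarith
    rw [← h, this]; ring
  · obtain ⟨α, h0, h1, e⟩ := seg L1 U1 y1 a1 b1
    refine ⟨α, h0, h1, e, ?_⟩
    have : y2 = L2 := by linarith
    rw [← h, this]; ring

set_option maxHeartbeats 1000000 in
theorem stmt11 (m : ℕ) (hm : 1 ≤ m)
    (hne : (Finset.univ : Finset (Fin m)).Nonempty)
    (r1 r2 w d : Fin m → ℝ) (hd : ∀ j, 0 ≤ d j)
    (s t : ℝ) (hst : s ≤ t)
    (p1 p2 q1 q2 g1 g2 h1 h2 : ℝ)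
    (hp1 : p1 = Finset.univ.sup' hne fun j => w j + r1 j + r2 j)
    (hp2 : p2 = Finset.univ.sup' hne fun j => w j - r1 j + r2 j)
    (hq1 : q1 = Finset.univ.inf' hne fun j => -w j + r1 j + r2 j)
    (hq2 : q2 = Finset.univ.inf' hne fun j => -w j - r1 j + r2 j)
    (hg1 : g1 = Finset.univ.sup' hne fun j => -d j + r1 j + r2 j)
    (hg2 : g2 = Finset.univ.sup' hne fun j => -d j - r1 j + r2 j)
    (hh1 : h1 = Finset.univ.inf' hne fun j => d j + r1 j + r2 j)
    (hh2 : h2 = Finset.univ.inf' hne fun j => d j - r1 j + r2 j)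
    (hfeas : max (max (g1 - h1) (g1 - h2 - 2 * t)) (max (g2 - h1 + 2 * s) (g2 - h2)) ≤ 0)
    (θ : ℝ)
    (hθ : θ = max
      (max (max ((p1 - q1) / 2) ((p1 - q2) / 2 - t)) (max ((p2 - q1) / 2 + s) ((p2 - q2) / 2)))
      (max
        (max (max (p1 - h1) (p1 - h2 - 2 * t)) (max (p2 - h1 + 2 * s) (p2 - h2)))
        (max (max (g1 - q1) (g1 - q2 - 2 * t)) (max (g2 - q1 + 2 * s) (g2 - q2))))) :
    ∀ x1 x2 : ℝ,
      ((∀ j, |x1 - r1 j| + |x2 - r2 j| ≤ d j) ∧ s ≤ x1 ∧ x1 ≤ t ∧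
       (Finset.univ.sup' hne fun j => w j + |x1 - r1 j| + |x2 - r2 j|) = θ)
      ↔
      (∃ α : ℝ, 0 ≤ α ∧ α ≤ 1 ∧
        x1 = (max ((1 - α) * max g1 (p1 - θ) +
                α * min (min h1 (q1 + θ)) (min (h2 + 2 * t) (q2 + 2 * t + θ)))
              ((1 - α) * max g2 (p2 - θ) +
                α * min (min (h1 - 2 * s) (q1 - 2 * s + θ)) (min h2 (q2 + θ)) + 2 * s)
             - max ((1 - α) * max g1 (p1 - θ) +
                α * min (min h1 (q1 + θ)) (min (h2 + 2 * t) (q2 + 2 * t + θ)) - 2 * t)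
              ((1 - α) * max g2 (p2 - θ) +
                α * min (min (h1 - 2 * s) (q1 - 2 * s + θ)) (min h2 (q2 + θ)))) / 2 ∧
        x2 = (max ((1 - α) * max g1 (p1 - θ) +
                α * min (min h1 (q1 + θ)) (min (h2 + 2 * t) (q2 + 2 * t + θ)))
              ((1 - α) * max g2 (p2 - θ) +
                α * min (min (h1 - 2 * s) (q1 - 2 * s + θ)) (min h2 (q2 + θ)) + 2 * s)
             + max ((1 - α) * max g1 (p1 - θ) +
                α * min (min h1 (q1 + θ)) (min (h2 + 2 * t) (q2 + 2 * t + θ)) - 2 * t)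
              ((1 - α) * max g2 (p2 - θ) +
                α * min (min (h1 - 2 * s) (q1 - 2 * s + θ)) (min h2 (q2 + θ)))) / 2) := by
  intro x1 x2
  have hball : (∀ j, |x1 - r1 j| + |x2 - r2 j| ≤ d j) ↔
      (g1 ≤ x1 + x2 ∧ x1 + x2 ≤ h1 ∧ g2 ≤ x2 - x1 ∧ x2 - x1 ≤ h2) := by
    simp only [abs_add_abs_le_iff', hg1, hg2, hh1, hh2, Finset.sup'_le_iff, Finset.le_inf'_iff,
      Finset.mem_univ, true_implies, ← forall_and]
    refine forall_congr' fun j => ?_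
    constructor
    · rintro ⟨_, _, _, _⟩
      refine ⟨?_, ?_, ?_, ?_⟩ <;> linarith
    · rintro ⟨_, _, _, _⟩
      refine ⟨?_, ?_, ?_, ?_⟩ <;> linarith
  have hobj : ∀ τ : ℝ, (Finset.univ.sup' hne fun j => w j + |x1 - r1 j| + |x2 - r2 j|) ≤ τ ↔
      (p1 ≤ x1 + x2 + τ ∧ x1 + x2 - τ ≤ q1 ∧ p2 ≤ x2 - x1 + τ ∧ x2 - x1 - τ ≤ q2) := by
    intro τ
    have e : ∀ j, w j + |x1 - r1 j| + |x2 - r2 j| ≤ τ ↔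
        |x1 - r1 j| + |x2 - r2 j| ≤ τ - w j := by
      intro j
      constructor <;> intro h <;> linarith
    simp only [hp1, hp2, hq1, hq2, Finset.sup'_le_iff, Finset.le_inf'_iff,
      Finset.mem_univ, true_implies, ← forall_and, e, abs_add_abs_le_iff']
    refine forall_congr' fun j => ?_
    constructor
    · rintro ⟨_, _, _, _⟩
      refine ⟨?_, ?_, ?_, ?_⟩ <;> linarith
    · rintro ⟨_, _, _, _⟩
      refine ⟨?_, ?_, ?_, ?_⟩ <;> linarith
  generalize (Finset.univ.sup' hne fun j => w j + |x1 - r1 j| + |x2 - r2 j|) = F at hobj ⊢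
  rw [hball]
  clear hball hp1 hp2 hq1 hq2 hg1 hg2 hh1 hh2
  -- facts on θ
  have hθle := hθ.ge
  simp only [max_le_iff] at hθle hfeas
  obtain ⟨⟨⟨t1, t2⟩, t3, t4⟩, ⟨⟨t5, t6⟩, t7, t8⟩, ⟨t9, t10⟩, t11, t12⟩ := hθle
  obtain ⟨⟨f1, f2⟩, f3, f4⟩ := hfeas
  -- the interval endpoints
  obtain ⟨L1, hL1⟩ : ∃ L, L = max g1 (p1 - θ) := ⟨_, rfl⟩
  obtain ⟨L2, hL2⟩ : ∃ L, L = max g2 (p2 - θ) := ⟨_, rfl⟩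
  obtain ⟨U1, hU1⟩ : ∃ U, U = min (min h1 (q1 + θ)) (min (h2 + 2 * t) (q2 + 2 * t + θ)) := ⟨_, rfl⟩
  obtain ⟨U2, hU2⟩ : ∃ U, U = min (min (h1 - 2 * s) (q1 - 2 * s + θ)) (min h2 (q2 + θ)) := ⟨_, rfl⟩
  rw [← hL1, ← hL2, ← hU1, ← hU2]
  have l1 := hL1.ge
  have l2 := hL2.ge
  have v1 := hU1.le
  have v2 := hU2.le
  simp only [max_le_iff, le_min_iff] at l1 l2 v1 v2
  obtain ⟨l1a, l1b⟩ := l1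
  obtain ⟨l2a, l2b⟩ := l2
  obtain ⟨⟨v1a, v1b⟩, v1c, v1d⟩ := v1
  obtain ⟨⟨v2a, v2b⟩, v2c, v2d⟩ := v2
  have hLU1 : L1 ≤ U1 := by
    rw [hL1, hU1]
    refine max_le (le_min (le_min ?_ ?_) (le_min ?_ ?_)) (le_min (le_min ?_ ?_) (le_min ?_ ?_)) <;>
      linarith
  have hLU2 : L2 ≤ U2 := by
    rw [hL2, hU2]
    refine max_le (le_min (le_min ?_ ?_) (le_min ?_ ?_)) (le_min (le_min ?_ ?_) (le_min ?_ ?_)) <;>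
      linarith
  have hdeg : L1 = U1 ∨ L2 = U2 := by
    by_contra hcon
    push Not at hcon
    have c1 := lt_of_le_of_ne hLU1 hcon.1
    have c2 := lt_of_le_of_ne hLU2 hcon.2
    have : θ < θ := by
      conv_lhs => rw [hθ]
      simp only [max_lt_iff]
      refine ⟨⟨⟨?_, ?_⟩, ?_, ?_⟩, ⟨⟨?_, ?_⟩, ?_, ?_⟩, ⟨?_, ?_⟩, ?_, ?_⟩ <;> linarith
    exact lt_irrefl _ this
  constructor
  · rintro ⟨⟨b1, b2, b3, b4⟩, hs, ht, hF⟩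
    obtain ⟨o1, o2, o3, o4⟩ := (hobj θ).1 hF.le
    have a1 : L1 ≤ x1 + x2 := by
      rw [hL1]; refine max_le ?_ ?_ <;> linarith
    have a2 : L2 ≤ x2 - x1 := by
      rw [hL2]; refine max_le ?_ ?_ <;> linarith
    have a3 : x1 + x2 ≤ U1 := by
      rw [hU1]; refine le_min (le_min ?_ ?_) (le_min ?_ ?_) <;> linarith
    have a4 : x2 - x1 ≤ U2 := by
      rw [hU2]; refine le_min (le_min ?_ ?_) (le_min ?_ ?_) <;> linarith
    obtain ⟨α, h0, h1', e1, e2⟩ := exists_param L1 U1 L2 U2 _ _ hdeg a1 a3 a2 a4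
    refine ⟨α, h0, h1', ?_⟩
    rw [e1, e2, max_eq_left (by linarith : x2 - x1 + 2 * s ≤ x1 + x2),
      max_eq_right (by linarith : x1 + x2 - 2 * t ≤ x2 - x1)]
    constructor <;> ring
  · rintro ⟨α, h0, h1', e1, e2⟩
    have k1 : L1 ≤ (1 - α) * L1 + α * U1 := (seg_bounds L1 U1 α hLU1 h0 h1').1
    have k2 : (1 - α) * L1 + α * U1 ≤ U1 := (seg_bounds L1 U1 α hLU1 h0 h1').2
    have k3 : L2 ≤ (1 - α) * L2 + α * U2 := (seg_bounds L2 U2 α hLU2 h0 h1').1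
    have k4 : (1 - α) * L2 + α * U2 ≤ U2 := (seg_bounds L2 U2 α hLU2 h0 h1').2
    generalize (1 - α) * L1 + α * U1 = u1 at *
    generalize (1 - α) * L2 + α * U2 = u2 at *
    obtain ⟨y1, hy1⟩ : ∃ y, y = max u1 (u2 + 2 * s) := ⟨_, rfl⟩
    obtain ⟨y2, hy2⟩ : ∃ y, y = max (u1 - 2 * t) u2 := ⟨_, rfl⟩
    rw [← hy1, ← hy2] at e1 e2
    have m1 : u1 ≤ y1 := hy1 ▸ le_max_left _ _
    have m2 : u2 + 2 * s ≤ y1 := hy1 ▸ le_max_right _ _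
    have m3 : u1 - 2 * t ≤ y2 := hy2 ▸ le_max_left _ _
    have m4 : u2 ≤ y2 := hy2 ▸ le_max_right _ _
    have n1 : y1 ≤ h1 := by rw [hy1]; refine max_le ?_ ?_ <;> linarith
    have n2 : y1 ≤ q1 + θ := by rw [hy1]; refine max_le ?_ ?_ <;> linarith
    have n3 : y2 ≤ h2 := by rw [hy2]; refine max_le ?_ ?_ <;> linarith
    have n4 : y2 ≤ q2 + θ := by rw [hy2]; refine max_le ?_ ?_ <;> linarith
    have n5 : y1 ≤ y2 + 2 * t := by rw [hy1]; refine max_le ?_ ?_ <;> linarith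
    have n6 : y2 ≤ y1 - 2 * s := by rw [hy2]; refine max_le ?_ ?_ <;> linarith
    have z1 : x1 + x2 = y1 := by rw [e1, e2]; ring
    have z2 : x2 - x1 = y2 := by rw [e1, e2]; ring
    refine ⟨⟨?_, ?_, ?_, ?_⟩, ?_, ?_, le_antisymm ((hobj θ).2 ⟨?_, ?_, ?_, ?_⟩) ?_⟩
    on_goal 11 =>
      obtain ⟨o1, o2, o3, o4⟩ := (hobj F).1 le_rfl
      rw [hθ]
      simp only [max_le_iff]
      refine ⟨⟨⟨?_, ?_⟩, ?_, ?_⟩, ⟨⟨?_, ?_⟩, ?_, ?_⟩, ⟨?_, ?_⟩, ?_, ?_⟩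
    all_goals linarith
end

section
/- Assume max( g1 − h1, g2 − h2 ) ≤ 0, and define θ = max( (p1−q1)/2, (p2−q2)/2, p1 − h1, p2 − h2, g1 − q1, g2 − q2 ). Then every (x1, x2) ∈ ℝ² satisfying |x1 − r_{1j}| + |x2 − r_{2j}| ≤ d_j for all j = 1,…,m has max over j of ( w_j + |x1 − r_{1j}| + |x2 − r_{2j}| ) ≥ θ, and there exists such a feasible point (x1, x2) for which this maximum equals θ. -/
theorem l1_le_iff (a b t : ℝ) :
    |a| + |b| ≤ t ↔ a + b ≤ t ∧ -(a + b) ≤ t ∧ b - a ≤ t ∧ a - b ≤ t := by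
  constructor
  · intro h
    have h1 := le_abs_self a
    have h2 := le_abs_self b
    have h3 := neg_abs_le a
    have h4 := neg_abs_le b
    refine ⟨?_, ?_, ?_, ?_⟩ <;> linarith
  · rintro ⟨h1, h2, h3, h4⟩
    rcases abs_cases a with ⟨ha, _⟩ | ⟨ha, _⟩ <;> rcases abs_cases b with ⟨hb, _⟩ | ⟨hb, _⟩ <;>
      rw [ha, hb] <;> linarith

theorem stmt12 (m : ℕ) (hm : 1 ≤ m)
    (hne : (Finset.univ : Finset (Fin m)).Nonempty)
    (r1 r2 w d : Fin m → ℝ) (hd : ∀ j, 0 ≤ d j)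
    (p1 p2 q1 q2 g1 g2 h1 h2 : ℝ)
    (hp1 : p1 = Finset.univ.sup' hne fun j => w j + r1 j + r2 j)
    (hp2 : p2 = Finset.univ.sup' hne fun j => w j - r1 j + r2 j)
    (hq1 : q1 = Finset.univ.inf' hne fun j => -w j + r1 j + r2 j)
    (hq2 : q2 = Finset.univ.inf' hne fun j => -w j - r1 j + r2 j)
    (hg1 : g1 = Finset.univ.sup' hne fun j => -d j + r1 j + r2 j)
    (hg2 : g2 = Finset.univ.sup' hne fun j => -d j - r1 j + r2 j)
    (hh1 : h1 = Finset.univ.inf' hne fun j => d j + r1 j + r2 j)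
    (hh2 : h2 = Finset.univ.inf' hne fun j => d j - r1 j + r2 j)
    (hfeas : max (g1 - h1) (g2 - h2) ≤ 0)
    (θ : ℝ)
    (hθ : θ = max (max (max ((p1 - q1) / 2) ((p2 - q2) / 2)) (max (p1 - h1) (p2 - h2)))
              (max (g1 - q1) (g2 - q2))) :
    (∀ x1 x2 : ℝ,
      (∀ j, |x1 - r1 j| + |x2 - r2 j| ≤ d j) →
      θ ≤ Finset.univ.sup' hne fun j => w j + |x1 - r1 j| + |x2 - r2 j|) ∧
    (∃ x1 x2 : ℝ,
      (∀ j, |x1 - r1 j| + |x2 - r2 j| ≤ d j) ∧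
      (Finset.univ.sup' hne fun j => w j + |x1 - r1 j| + |x2 - r2 j|) = θ) := by
  have lower : ∀ x1 x2 : ℝ,
      (∀ j, |x1 - r1 j| + |x2 - r2 j| ≤ d j) →
      θ ≤ Finset.univ.sup' hne fun j => w j + |x1 - r1 j| + |x2 - r2 j| := by
    intro x1 x2 hx
    set S := Finset.univ.sup' hne fun j => w j + |x1 - r1 j| + |x2 - r2 j| with hS
    have hle : ∀ j, |x1 - r1 j| + |x2 - r2 j| ≤ S - w j := by
      intro j
      have := Finset.le_sup' (fun j => w j + |x1 - r1 j| + |x2 - r2 j|) (Finset.mem_univ j)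
      simp only [← hS] at this
      linarith
    simp only [l1_le_iff] at hx hle
    have a1 : p1 ≤ S + (x1 + x2) := by
      rw [hp1]; refine Finset.sup'_le _ _ fun j _ => ?_
      obtain ⟨b1, b2, b3, b4⟩ := hle j; linarith
    have a2 : p2 ≤ S + (x2 - x1) := by
      rw [hp2]; refine Finset.sup'_le _ _ fun j _ => ?_
      obtain ⟨b1, b2, b3, b4⟩ := hle j; linarith
    have a3 : (x1 + x2) - S ≤ q1 := by
      rw [hq1]; refine Finset.le_inf' _ _ fun j _ => ?_
      obtain ⟨b1, b2, b3, b4⟩ := hle j; linarith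
    have a4 : (x2 - x1) - S ≤ q2 := by
      rw [hq2]; refine Finset.le_inf' _ _ fun j _ => ?_
      obtain ⟨b1, b2, b3, b4⟩ := hle j; linarith
    have a5 : g1 ≤ x1 + x2 := by
      rw [hg1]; refine Finset.sup'_le _ _ fun j _ => ?_
      obtain ⟨b1, b2, b3, b4⟩ := hx j; linarith
    have a6 : g2 ≤ x2 - x1 := by
      rw [hg2]; refine Finset.sup'_le _ _ fun j _ => ?_
      obtain ⟨b1, b2, b3, b4⟩ := hx j; linarith
    have a7 : x1 + x2 ≤ h1 := by
      rw [hh1]; refine Finset.le_inf' _ _ fun j _ => ?_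
      obtain ⟨b1, b2, b3, b4⟩ := hx j; linarith
    have a8 : x2 - x1 ≤ h2 := by
      rw [hh2]; refine Finset.le_inf' _ _ fun j _ => ?_
      obtain ⟨b1, b2, b3, b4⟩ := hx j; linarith
    rw [hθ]
    simp only [max_le_iff]
    refine ⟨⟨⟨?_, ?_⟩, ?_, ?_⟩, ?_, ?_⟩ <;> linarith
  refine ⟨lower, ?_⟩
  have ht := hθ.ge
  simp only [max_le_iff] at ht hfeas
  obtain ⟨⟨⟨t1, t2⟩, t3, t4⟩, t5, t6⟩ := ht
  obtain ⟨f1, f2⟩ := hfeas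
  obtain ⟨u, u1, u2, u3, u4⟩ : ∃ u, p1 - θ ≤ u ∧ g1 ≤ u ∧ u ≤ q1 + θ ∧ u ≤ h1 :=
    ⟨max (p1 - θ) g1, le_max_left _ _, le_max_right _ _,
      max_le (by linarith) (by linarith), max_le (by linarith) (by linarith)⟩
  obtain ⟨v, v1, v2, v3, v4⟩ : ∃ v, p2 - θ ≤ v ∧ g2 ≤ v ∧ v ≤ q2 + θ ∧ v ≤ h2 :=
    ⟨max (p2 - θ) g2, le_max_left _ _, le_max_right _ _,
      max_le (by linarith) (by linarith), max_le (by linarith) (by linarith)⟩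
  have P1 : ∀ j, w j + r1 j + r2 j ≤ p1 := fun j => by
    rw [hp1]; exact Finset.le_sup' (fun j => w j + r1 j + r2 j) (Finset.mem_univ j)
  have P2 : ∀ j, w j - r1 j + r2 j ≤ p2 := fun j => by
    rw [hp2]; exact Finset.le_sup' (fun j => w j - r1 j + r2 j) (Finset.mem_univ j)
  have Q1 : ∀ j, q1 ≤ -w j + r1 j + r2 j := fun j => by
    rw [hq1]; exact Finset.inf'_le (fun j => -w j + r1 j + r2 j) (Finset.mem_univ j)
  have Q2 : ∀ j, q2 ≤ -w j - r1 j + r2 j := fun j => by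
    rw [hq2]; exact Finset.inf'_le (fun j => -w j - r1 j + r2 j) (Finset.mem_univ j)
  have G1 : ∀ j, -d j + r1 j + r2 j ≤ g1 := fun j => by
    rw [hg1]; exact Finset.le_sup' (fun j => -d j + r1 j + r2 j) (Finset.mem_univ j)
  have G2 : ∀ j, -d j - r1 j + r2 j ≤ g2 := fun j => by
    rw [hg2]; exact Finset.le_sup' (fun j => -d j - r1 j + r2 j) (Finset.mem_univ j)
  have H1 : ∀ j, h1 ≤ d j + r1 j + r2 j := fun j => by
    rw [hh1]; exact Finset.inf'_le (fun j => d j + r1 j + r2 j) (Finset.mem_univ j)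
  have H2 : ∀ j, h2 ≤ d j - r1 j + r2 j := fun j => by
    rw [hh2]; exact Finset.inf'_le (fun j => d j - r1 j + r2 j) (Finset.mem_univ j)
  have feas : ∀ j, |(u - v) / 2 - r1 j| + |(u + v) / 2 - r2 j| ≤ d j := by
    intro j
    rw [l1_le_iff]
    have := G1 j
    have := G2 j
    have := H1 j
    have := H2 j
    refine ⟨?_, ?_, ?_, ?_⟩ <;> linarith
  refine ⟨(u - v) / 2, (u + v) / 2, feas, le_antisymm ?_ (lower _ _ feas)⟩
  refine Finset.sup'_le _ _ fun j _ => ?_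
  have key : |(u - v) / 2 - r1 j| + |(u + v) / 2 - r2 j| ≤ θ - w j := by
    rw [l1_le_iff]
    have := P1 j
    have := P2 j
    have := Q1 j
    have := Q2 j
    refine ⟨?_, ?_, ?_, ?_⟩ <;> linarith
  linarith
end

section
/- Assume max( g1 − h1, g2 − h2 ) ≤ 0, and define θ = max( (p1−q1)/2, (p2−q2)/2, p1 − h1, p2 − h2, g1 − q1, g2 − q2 ). Then a point (x1, x2) ∈ ℝ² satisfies |x1 − r_{1j}| + |x2 − r_{2j}| ≤ d_j for all j and attains max_j ( w_j + |x1 − r_{1j}| + |x2 − r_{2j}| ) = θ if and only if there exists α ∈ [0,1] such that, with u1 = (1−α)·max(g1, p1 − θ) + α·min(h1, q1 + θ) and u2 = (1−α)·max(g2, p2 − θ) + α·min(h2, q2 + θ), one has x1 = (u1 − u2)/2 and x2 = (u1 + u2)/2. -/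
theorem abs_rot (a b c : ℝ) :
    |a| + |b| ≤ c ↔ (-c ≤ a + b ∧ a + b ≤ c ∧ -c ≤ b - a ∧ b - a ≤ c) := by
  constructor
  · intro h
    have := le_abs_self a
    have := neg_abs_le a
    have := le_abs_self b
    have := neg_abs_le b
    refine ⟨?_, ?_, ?_, ?_⟩ <;> linarith
  · rintro ⟨h1, h2, h3, h4⟩
    rcases abs_cases a with ⟨e, _⟩ | ⟨e, _⟩ <;> rcases abs_cases b with ⟨f, _⟩ | ⟨f, _⟩ <;>
      rw [e, f] <;> linarith

/-- parametrization of a rectangle with a degenerate side -/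
theorem rect_param (a1 b1 a2 b2 u1 u2 : ℝ) (h1 : a1 ≤ b1) (h2 : a2 ≤ b2)
    (hdeg : b1 ≤ a1 ∨ b2 ≤ a2) :
    (a1 ≤ u1 ∧ u1 ≤ b1 ∧ a2 ≤ u2 ∧ u2 ≤ b2) ↔
    ∃ α : ℝ, 0 ≤ α ∧ α ≤ 1 ∧ u1 = (1 - α) * a1 + α * b1 ∧ u2 = (1 - α) * a2 + α * b2 := by
  have seg : ∀ a b u : ℝ, a ≤ u → u ≤ b →
      ∃ α : ℝ, 0 ≤ α ∧ α ≤ 1 ∧ u = (1 - α) * a + α * b := by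
    intro a b u ha hb
    rcases eq_or_lt_of_le (ha.trans hb) with h | h
    · exact ⟨0, le_rfl, zero_le_one, by linarith⟩
    · have hp : 0 < b - a := by linarith
      refine ⟨(u - a) / (b - a), div_nonneg (by linarith) hp.le,
        (div_le_one hp).2 (by linarith), ?_⟩
      field_simp
      ring
  constructor
  · rintro ⟨k1, k2, k3, k4⟩
    rcases hdeg with h | h
    · obtain ⟨α, c1, c2, c3⟩ := seg a2 b2 u2 k3 k4
      have e : b1 = a1 := le_antisymm h h1
      have e' : u1 = a1 := le_antisymm (k2.trans h) k1
      exact ⟨α, c1, c2, by rw [e, e']; ring, c3⟩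
    · obtain ⟨α, c1, c2, c3⟩ := seg a1 b1 u1 k1 k2
      have e : b2 = a2 := le_antisymm h h2
      have e' : u2 = a2 := le_antisymm (k4.trans h) k3
      exact ⟨α, c1, c2, c3, by rw [e, e']; ring⟩
  · rintro ⟨α, c1, c2, rfl, rfl⟩
    refine ⟨?_, ?_, ?_, ?_⟩ <;> nlinarith

theorem stmt13 (m : ℕ) (hm : 1 ≤ m)
    (hne : (Finset.univ : Finset (Fin m)).Nonempty)
    (r1 r2 w d : Fin m → ℝ) (hd : ∀ j, 0 ≤ d j)
    (p1 p2 q1 q2 g1 g2 h1 h2 : ℝ)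
    (hp1 : p1 = Finset.univ.sup' hne fun j => w j + r1 j + r2 j)
    (hp2 : p2 = Finset.univ.sup' hne fun j => w j - r1 j + r2 j)
    (hq1 : q1 = Finset.univ.inf' hne fun j => -w j + r1 j + r2 j)
    (hq2 : q2 = Finset.univ.inf' hne fun j => -w j - r1 j + r2 j)
    (hg1 : g1 = Finset.univ.sup' hne fun j => -d j + r1 j + r2 j)
    (hg2 : g2 = Finset.univ.sup' hne fun j => -d j - r1 j + r2 j)
    (hh1 : h1 = Finset.univ.inf' hne fun j => d j + r1 j + r2 j)
    (hh2 : h2 = Finset.univ.inf' hne fun j => d j - r1 j + r2 j)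
    (hfeas : max (g1 - h1) (g2 - h2) ≤ 0)
    (θ : ℝ)
    (hθ : θ = max (max (max ((p1 - q1) / 2) ((p2 - q2) / 2)) (max (p1 - h1) (p2 - h2)))
              (max (g1 - q1) (g2 - q2))) :
    ∀ x1 x2 : ℝ,
      ((∀ j, |x1 - r1 j| + |x2 - r2 j| ≤ d j) ∧
       (Finset.univ.sup' hne fun j => w j + |x1 - r1 j| + |x2 - r2 j|) = θ)
      ↔
      (∃ α : ℝ, 0 ≤ α ∧ α ≤ 1 ∧
        x1 = (((1 - α) * max g1 (p1 - θ) + α * min h1 (q1 + θ)) -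
              ((1 - α) * max g2 (p2 - θ) + α * min h2 (q2 + θ))) / 2 ∧
        x2 = (((1 - α) * max g1 (p1 - θ) + α * min h1 (q1 + θ)) +
              ((1 - α) * max g2 (p2 - θ) + α * min h2 (q2 + θ))) / 2) := by
  intro x1 x2
  have hF : (∀ j, |x1 - r1 j| + |x2 - r2 j| ≤ d j) ↔
      (g1 ≤ x1 + x2 ∧ x1 + x2 ≤ h1 ∧ g2 ≤ x2 - x1 ∧ x2 - x1 ≤ h2) := by
    simp only [hg1, hg2, hh1, hh2, Finset.sup'_le_iff, Finset.le_inf'_iff, Finset.mem_univ,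
      true_imp_iff, abs_rot, forall_and]
    refine and_congr ?_ (and_congr ?_ (and_congr ?_ ?_)) <;>
      refine forall_congr' fun j => ?_ <;> constructor <;> intro h <;> linarith
  have hS : ∀ S : ℝ, (Finset.univ.sup' hne fun j => w j + |x1 - r1 j| + |x2 - r2 j|) ≤ S ↔
      (p1 - S ≤ x1 + x2 ∧ x1 + x2 ≤ q1 + S ∧ p2 - S ≤ x2 - x1 ∧ x2 - x1 ≤ q2 + S) := by
    intro S
    have e : ∀ j, w j + |x1 - r1 j| + |x2 - r2 j| ≤ S ↔ |x1 - r1 j| + |x2 - r2 j| ≤ S - w j := by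
      intro j; constructor <;> intro h <;> linarith
    have ep : ∀ a b : ℝ, a - S ≤ b ↔ a ≤ b + S := fun a b => sub_le_iff_le_add
    have eq : ∀ a b : ℝ, b ≤ a + S ↔ b - S ≤ a := fun a b => sub_le_iff_le_add.symm
    rw [ep p1, ep p2, eq q1, eq q2]
    simp only [hp1, hp2, hq1, hq2, Finset.sup'_le_iff, Finset.le_inf'_iff, Finset.mem_univ,
      true_imp_iff, e, abs_rot, forall_and]
    refine and_congr ?_ (and_congr ?_ (and_congr ?_ ?_)) <;>
      refine forall_congr' fun j => ?_ <;> constructor <;> intro h <;> linarith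
  obtain ⟨f1, f2⟩ := max_le_iff.1 hfeas
  have hle := hθ.ge
  simp only [max_le_iff] at hle
  obtain ⟨⟨⟨t1, t2⟩, t3, t4⟩, t5, t6⟩ := hle
  have hdeg : min h1 (q1 + θ) ≤ max g1 (p1 - θ) ∨ min h2 (q2 + θ) ≤ max g2 (p2 - θ) := by
    have hge := hθ.le
    simp only [le_max_iff] at hge
    simp only [le_max_iff, min_le_iff]
    rcases hge with ((h | h) | h | h) | h | h
    · left; right; right; linarith
    · right; right; right; linarith
    · left; right; left; linarith
    · right; right; left; linarith
    · left; left; right; linarith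
    · right; left; right; linarith
  have n1 : max g1 (p1 - θ) ≤ min h1 (q1 + θ) := by
    refine max_le (le_min ?_ ?_) (le_min ?_ ?_) <;> linarith
  have n2 : max g2 (p2 - θ) ≤ min h2 (q2 + θ) := by
    refine max_le (le_min ?_ ?_) (le_min ?_ ?_) <;> linarith
  have key := rect_param _ _ _ _ (x1 + x2) (x2 - x1) n1 n2 hdeg
  have hL : ((∀ j, |x1 - r1 j| + |x2 - r2 j| ≤ d j) ∧
       (Finset.univ.sup' hne fun j => w j + |x1 - r1 j| + |x2 - r2 j|) = θ) ↔
      (max g1 (p1 - θ) ≤ x1 + x2 ∧ x1 + x2 ≤ min h1 (q1 + θ) ∧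
        max g2 (p2 - θ) ≤ x2 - x1 ∧ x2 - x1 ≤ min h2 (q2 + θ)) := by
    simp only [max_le_iff, le_min_iff]
    constructor
    · rintro ⟨hf, hs⟩
      obtain ⟨a1, a2, a3, a4⟩ := hF.1 hf
      obtain ⟨b1, b2, b3, b4⟩ := (hS θ).1 hs.le
      exact ⟨⟨a1, b1⟩, ⟨a2, b2⟩, ⟨a3, b3⟩, ⟨a4, b4⟩⟩
    · rintro ⟨⟨a1, b1⟩, ⟨a2, b2⟩, ⟨a3, b3⟩, ⟨a4, b4⟩⟩
      refine ⟨hF.2 ⟨a1, a2, a3, a4⟩, le_antisymm ((hS θ).2 ⟨b1, b2, b3, b4⟩) ?_⟩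
      obtain ⟨c1, c2, c3, c4⟩ := (hS _).1 le_rfl
      refine hθ.le.trans ?_
      refine max_le (max_le (max_le ?_ ?_) (max_le ?_ ?_)) (max_le ?_ ?_) <;> linarith
  rw [hL, key]
  refine exists_congr fun α => and_congr_right fun _ => and_congr_right fun _ => ?_
  constructor
  · rintro ⟨k1, k2⟩
    rw [← k1, ← k2]
    constructor <;> ring
  · rintro ⟨k1, k2⟩
    constructor <;> linarith
end

section
/- Define θ = (1/2)·max( p1 − q1, p1 − q2 − 2t, p2 − q1 + 2s, p2 − q2 ). Then every (x1, x2) ∈ ℝ² with s ≤ x1 ≤ t has max over j = 1,…,m of ( w_j + |x1 − r_{1j}| + |x2 − r_{2j}| ) ≥ θ, and there exists (x1, x2) with s ≤ x1 ≤ t for which this maximum equals θ. -/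
theorem stmt14 (m : ℕ) (hm : 1 ≤ m)
    (hne : (Finset.univ : Finset (Fin m)).Nonempty)
    (r1 r2 w : Fin m → ℝ)
    (s t : ℝ) (hst : s ≤ t)
    (p1 p2 q1 q2 : ℝ)
    (hp1 : p1 = Finset.univ.sup' hne fun j => w j + r1 j + r2 j)
    (hp2 : p2 = Finset.univ.sup' hne fun j => w j - r1 j + r2 j)
    (hq1 : q1 = Finset.univ.inf' hne fun j => -w j + r1 j + r2 j)
    (hq2 : q2 = Finset.univ.inf' hne fun j => -w j - r1 j + r2 j)
    (θ : ℝ)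
    (hθ : θ = (1 / 2) * max (max (p1 - q1) (p1 - q2 - 2 * t))
                            (max (p2 - q1 + 2 * s) (p2 - q2))) :
    (∀ x1 x2 : ℝ, s ≤ x1 → x1 ≤ t →
      θ ≤ Finset.univ.sup' hne fun j => w j + |x1 - r1 j| + |x2 - r2 j|) ∧
    (∃ x1 x2 : ℝ, s ≤ x1 ∧ x1 ≤ t ∧
      (Finset.univ.sup' hne fun j => w j + |x1 - r1 j| + |x2 - r2 j|) = θ) := by
  have key : ∀ x1 x2 c : ℝ,
      (Finset.univ.sup' hne fun j => w j + |x1 - r1 j| + |x2 - r2 j|) ≤ c ↔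
      (p1 ≤ c + x1 + x2 ∧ p2 ≤ c - x1 + x2 ∧ x1 + x2 - c ≤ q1 ∧ x2 - x1 - c ≤ q2) := by
    intro x1 x2 c
    rw [hp1, hp2, hq1, hq2]
    simp only [Finset.sup'_le_iff, Finset.le_inf'_iff]
    constructor
    · intro h
      refine ⟨fun j hj => ?_, fun j hj => ?_, fun j hj => ?_, fun j hj => ?_⟩ <;>
      · have := h j hj
        have a1 := le_abs_self (x1 - r1 j)
        have a2 := neg_abs_le (x1 - r1 j)
        have a3 := le_abs_self (x2 - r2 j)
        have a4 := neg_abs_le (x2 - r2 j)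
        linarith
    · rintro ⟨h1, h2, h3, h4⟩ j hj
      have h1 := h1 j hj
      have h2 := h2 j hj
      have h3 := h3 j hj
      have h4 := h4 j hj
      rcases abs_cases (x1 - r1 j) with ⟨e, _⟩ | ⟨e, _⟩ <;>
      rcases abs_cases (x2 - r2 j) with ⟨e', _⟩ | ⟨e', _⟩ <;>
      · rw [e, e']
        linarith
  have lower : ∀ x1 x2 : ℝ, s ≤ x1 → x1 ≤ t →
      θ ≤ Finset.univ.sup' hne fun j => w j + |x1 - r1 j| + |x2 - r2 j| := by
    intro x1 x2 hs ht
    obtain ⟨h1, h2, h3, h4⟩ := (key x1 x2 _).1 le_rfl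
    generalize (Finset.univ.sup' hne fun j => w j + |x1 - r1 j| + |x2 - r2 j|) = c at *
    have : max (max (p1 - q1) (p1 - q2 - 2 * t))
        (max (p2 - q1 + 2 * s) (p2 - q2)) ≤ 2 * c := by
      refine max_le (max_le ?_ ?_) (max_le ?_ ?_) <;> linarith
    linarith
  refine ⟨lower, ?_⟩
  have hM : max (max (p1 - q1) (p1 - q2 - 2 * t))
      (max (p2 - q1 + 2 * s) (p2 - q2)) ≤ 2 * θ := by linarith
  simp only [max_le_iff] at hM
  obtain ⟨⟨b1, b2⟩, b3, b4⟩ := hM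
  obtain ⟨x1, hs, ht, c1, c2⟩ : ∃ x1, s ≤ x1 ∧ x1 ≤ t ∧ (p1 - q2) / 2 - θ ≤ x1 ∧
      x1 ≤ θ - (p2 - q1) / 2 :=
    ⟨max s ((p1 - q2) / 2 - θ), le_max_left _ _, max_le hst (by linarith), le_max_right _ _,
      max_le (by linarith) (by linarith)⟩
  have d1 := le_max_left (p1 - x1) (p2 + x1)
  have d2 := le_max_right (p1 - x1) (p2 + x1)
  have d3 : max (p1 - x1) (p2 + x1) ≤ 2 * θ + q1 - x1 := max_le (by linarith) (by linarith)
  have d4 : max (p1 - x1) (p2 + x1) ≤ 2 * θ + q2 + x1 := max_le (by linarith) (by linarith)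
  refine ⟨x1, max (p1 - x1) (p2 + x1) - θ, hs, ht, le_antisymm ?_ (lower _ _ hs ht)⟩
  rw [key]
  refine ⟨?_, ?_, ?_, ?_⟩ <;> linarith
end

section
/- Define θ = (1/2)·max( p1 − q1, p2 − q2 ). Then every (x1, x2) ∈ ℝ² has max over j = 1,…,m of ( w_j + |x1 − r_{1j}| + |x2 − r_{2j}| ) ≥ θ, and there exists (x1, x2) ∈ ℝ² for which this maximum equals θ. -/
theorem stmt16 (m : ℕ) (hm : 1 ≤ m)
    (hne : (Finset.univ : Finset (Fin m)).Nonempty)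
    (r1 r2 w : Fin m → ℝ)
    (p1 p2 q1 q2 : ℝ)
    (hp1 : p1 = Finset.univ.sup' hne fun j => w j + r1 j + r2 j)
    (hp2 : p2 = Finset.univ.sup' hne fun j => w j - r1 j + r2 j)
    (hq1 : q1 = Finset.univ.inf' hne fun j => -w j + r1 j + r2 j)
    (hq2 : q2 = Finset.univ.inf' hne fun j => -w j - r1 j + r2 j)
    (θ : ℝ)
    (hθ : θ = (1 / 2) * max (p1 - q1) (p2 - q2)) :
    (∀ x1 x2 : ℝ,
      θ ≤ Finset.univ.sup' hne fun j => w j + |x1 - r1 j| + |x2 - r2 j|) ∧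
    (∃ x1 x2 : ℝ,
      (Finset.univ.sup' hne fun j => w j + |x1 - r1 j| + |x2 - r2 j|) = θ) := by
  have lower : ∀ x1 x2 : ℝ,
      θ ≤ Finset.univ.sup' hne fun j => w j + |x1 - r1 j| + |x2 - r2 j| := by
    intro x1 x2
    have hS : ∀ j, w j + |x1 - r1 j| + |x2 - r2 j| ≤
        Finset.univ.sup' hne fun j => w j + |x1 - r1 j| + |x2 - r2 j| := fun j =>
      Finset.le_sup' (fun j => w j + |x1 - r1 j| + |x2 - r2 j|) (Finset.mem_univ j)
    generalize (Finset.univ.sup' hne fun j => w j + |x1 - r1 j| + |x2 - r2 j|) = S at hS ⊢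
    have a1 := fun j => le_abs_self (x1 - r1 j)
    have a2 := fun j => le_abs_self (x2 - r2 j)
    have b1 := fun j => neg_abs_le (x1 - r1 j)
    have b2 := fun j => neg_abs_le (x2 - r2 j)
    have h1 : p1 ≤ S + x1 + x2 := by
      rw [hp1]
      exact Finset.sup'_le _ _ fun j _ => by linarith [hS j, a1 j, a2 j, b1 j, b2 j]
    have h2 : p2 ≤ S - x1 + x2 := by
      rw [hp2]
      exact Finset.sup'_le _ _ fun j _ => by linarith [hS j, a1 j, a2 j, b1 j, b2 j]
    have h3 : x1 + x2 - S ≤ q1 := by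
      rw [hq1]
      exact Finset.le_inf' _ _ fun j _ => by linarith [hS j, a1 j, a2 j, b1 j, b2 j]
    have h4 : -x1 + x2 - S ≤ q2 := by
      rw [hq2]
      exact Finset.le_inf' _ _ fun j _ => by linarith [hS j, a1 j, a2 j, b1 j, b2 j]
    have : max (p1 - q1) (p2 - q2) ≤ 2 * S := max_le (by linarith) (by linarith)
    linarith
  refine ⟨lower, (p1 + q1) / 4 - (p2 + q2) / 4, (p1 + q1) / 4 + (p2 + q2) / 4,
    le_antisymm ?_ (lower _ _)⟩
  refine Finset.sup'_le _ _ fun j _ => ?_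
  have h1 : w j + r1 j + r2 j ≤ p1 := by
    rw [hp1]; exact Finset.le_sup' (fun j => w j + r1 j + r2 j) (Finset.mem_univ j)
  have h2 : w j - r1 j + r2 j ≤ p2 := by
    rw [hp2]; exact Finset.le_sup' (fun j => w j - r1 j + r2 j) (Finset.mem_univ j)
  have h3 : q1 ≤ -w j + r1 j + r2 j := by
    rw [hq1]; exact Finset.inf'_le (fun j => -w j + r1 j + r2 j) (Finset.mem_univ j)
  have h4 : q2 ≤ -w j - r1 j + r2 j := by
    rw [hq2]; exact Finset.inf'_le (fun j => -w j - r1 j + r2 j) (Finset.mem_univ j)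
  have m1 := le_max_left (p1 - q1) (p2 - q2)
  have m2 := le_max_right (p1 - q1) (p2 - q2)
  rcases abs_cases ((p1 + q1) / 4 - (p2 + q2) / 4 - r1 j) with ⟨e, _⟩ | ⟨e, _⟩ <;>
  rcases abs_cases ((p1 + q1) / 4 + (p2 + q2) / 4 - r2 j) with ⟨f, _⟩ | ⟨f, _⟩ <;>
  rw [e, f] <;> linarith
end

section
/- Define θ = (1/2)·max( p1 − q1, p2 − q2 ). Then a point (x1, x2) ∈ ℝ² attains max_j ( w_j + |x1 − r_{1j}| + |x2 − r_{2j}| ) = θ if and only if there exists α ∈ [0,1] such that, with u1 = (1−α)·(p1 − θ) + α·(q1 + θ) and u2 = (1−α)·(p2 − θ) + α·(q2 + θ), one has x1 = (u1 − u2)/2 and x2 = (u1 + u2)/2. -/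
theorem stmt17 (m : ℕ) (hm : 1 ≤ m)
    (hne : (Finset.univ : Finset (Fin m)).Nonempty)
    (r1 r2 w : Fin m → ℝ)
    (p1 p2 q1 q2 : ℝ)
    (hp1 : p1 = Finset.univ.sup' hne fun j => w j + r1 j + r2 j)
    (hp2 : p2 = Finset.univ.sup' hne fun j => w j - r1 j + r2 j)
    (hq1 : q1 = Finset.univ.inf' hne fun j => -w j + r1 j + r2 j)
    (hq2 : q2 = Finset.univ.inf' hne fun j => -w j - r1 j + r2 j)
    (θ : ℝ)
    (hθ : θ = (1 / 2) * max (p1 - q1) (p2 - q2)) :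
    ∀ x1 x2 : ℝ,
      (Finset.univ.sup' hne fun j => w j + |x1 - r1 j| + |x2 - r2 j|) = θ
      ↔
      (∃ α : ℝ, 0 ≤ α ∧ α ≤ 1 ∧
        x1 = (((1 - α) * (p1 - θ) + α * (q1 + θ)) -
              ((1 - α) * (p2 - θ) + α * (q2 + θ))) / 2 ∧
        x2 = (((1 - α) * (p1 - θ) + α * (q1 + θ)) +
              ((1 - α) * (p2 - θ) + α * (q2 + θ))) / 2) := by
  intro x1 x2
  have key : ∀ M : ℝ, (Finset.univ.sup' hne fun j => w j + |x1 - r1 j| + |x2 - r2 j|) ≤ M ↔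
      (p1 ≤ x1 + x2 + M ∧ x1 + x2 - M ≤ q1 ∧ p2 ≤ x2 - x1 + M ∧ x2 - x1 - M ≤ q2) := by
    intro M
    rw [hp1, hp2, hq1, hq2]
    simp only [Finset.sup'_le_iff, Finset.le_inf'_iff, Finset.mem_univ, true_implies]
    constructor
    · intro h
      refine ⟨fun j => ?_, fun j => ?_, fun j => ?_, fun j => ?_⟩ <;>
      · have := h j
        have a1 := le_abs_self (x1 - r1 j)
        have a2 := neg_le_abs (x1 - r1 j)
        have a3 := le_abs_self (x2 - r2 j)
        have a4 := neg_le_abs (x2 - r2 j)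
        linarith
    · rintro ⟨h1, h2, h3, h4⟩ j
      have := h1 j
      have := h2 j
      have := h3 j
      have := h4 j
      rcases abs_cases (x1 - r1 j) with h | h <;> rcases abs_cases (x2 - r2 j) with h' | h' <;>
        linarith
  clear hp1 hp2 hq1 hq2
  generalize (Finset.univ.sup' hne fun j => w j + |x1 - r1 j| + |x2 - r2 j|) = S at key ⊢
  have hS := (key S).1 le_rfl
  have hT := key θ
  have h1 : p1 - q1 ≤ 2 * θ := by have := le_max_left (p1 - q1) (p2 - q2); linarith
  have h2 : p2 - q2 ≤ 2 * θ := by have := le_max_right (p1 - q1) (p2 - q2); linarith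
  have h3 : p1 - q1 = 2 * θ ∨ p2 - q2 = 2 * θ := by
    rcases max_choice (p1 - q1) (p2 - q2) with h | h
    · left; linarith
    · right; linarith
  have hge : θ ≤ S := by
    rcases h3 with h | h <;> linarith
  have interp : ∀ a b t : ℝ, a ≤ t → t ≤ b → ∃ α : ℝ, 0 ≤ α ∧ α ≤ 1 ∧ t = (1 - α) * a + α * b := by
    intro a b t ha hb
    rcases eq_or_lt_of_le (ha.trans hb) with h | h
    · exact ⟨0, le_rfl, zero_le_one, by linarith⟩
    · have hba : 0 < b - a := by linarith
      refine ⟨(t - a) / (b - a), div_nonneg (by linarith) hba.le,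
        (div_le_one hba).2 (by linarith), ?_⟩
      field_simp
      ring
  constructor
  · intro h
    obtain ⟨b1, b2, b3, b4⟩ := hT.1 h.le
    rcases h3 with h | h
    · obtain ⟨α, h0, h1', e⟩ := interp (p2 - θ) (q2 + θ) (x2 - x1) (by linarith) (by linarith)
      have e1 : (1 - α) * (p1 - θ) + α * (q1 + θ) = x1 + x2 := by
        have ep : p1 - θ = x1 + x2 := by linarith
        have eq : q1 + θ = x1 + x2 := by linarith
        rw [ep, eq]; ring
      refine ⟨α, h0, h1', ?_, ?_⟩ <;> rw [e1, ← e] <;> ring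
    · obtain ⟨α, h0, h1', e⟩ := interp (p1 - θ) (q1 + θ) (x1 + x2) (by linarith) (by linarith)
      have e1 : (1 - α) * (p2 - θ) + α * (q2 + θ) = x2 - x1 := by
        have ep : p2 - θ = x2 - x1 := by linarith
        have eq : q2 + θ = x2 - x1 := by linarith
        rw [ep, eq]; ring
      refine ⟨α, h0, h1', ?_, ?_⟩ <;> rw [e1, ← e] <;> ring
  · rintro ⟨α, h0, h1', e1, e2⟩
    refine le_antisymm (hT.2 ?_) hge
    have k1 : 0 ≤ α * (q1 + θ - (p1 - θ)) := mul_nonneg h0 (by linarith)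
    have k2 : 0 ≤ α * (q2 + θ - (p2 - θ)) := mul_nonneg h0 (by linarith)
    have k3 : 0 ≤ (1 - α) * (q1 + θ - (p1 - θ)) := mul_nonneg (by linarith) (by linarith)
    have k4 : 0 ≤ (1 - α) * (q2 + θ - (p2 - θ)) := mul_nonneg (by linarith) (by linarith)
    refine ⟨?_, ?_, ?_, ?_⟩ <;> linarith
end

section
/- Assume max( g1 − h1, g1 − h2 − 2t, g2 − h1 + 2s, g2 − h2 ) ≤ 0, and define θ = max( (p1−q1)/2, (p1−q2)/2 − t, (p2−q1)/2 + s, (p2−q2)/2, p1 − h1, p1 − h2 − 2t, p2 − h1 + 2s, p2 − h2, g1 − q1, g1 − q2 − 2t, g2 − q1 + 2s, g2 − q2 ). Then at least one of the following two equalities holds: max(g1, p1 − θ) = min(h1, q1 + θ, h2 + 2t, q2 + 2t + θ), or max(g2, p2 − θ) = min(h1 − 2s, q1 − 2s + θ, h2, q2 + θ). -/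
theorem stmt18 (m : ℕ) (hm : 1 ≤ m)
    (hne : (Finset.univ : Finset (Fin m)).Nonempty)
    (r1 r2 w d : Fin m → ℝ) (hd : ∀ j, 0 ≤ d j)
    (s t : ℝ) (hst : s ≤ t)
    (p1 p2 q1 q2 g1 g2 h1 h2 : ℝ)
    (hp1 : p1 = Finset.univ.sup' hne fun j => w j + r1 j + r2 j)
    (hp2 : p2 = Finset.univ.sup' hne fun j => w j - r1 j + r2 j)
    (hq1 : q1 = Finset.univ.inf' hne fun j => -w j + r1 j + r2 j)
    (hq2 : q2 = Finset.univ.inf' hne fun j => -w j - r1 j + r2 j)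
    (hg1 : g1 = Finset.univ.sup' hne fun j => -d j + r1 j + r2 j)
    (hg2 : g2 = Finset.univ.sup' hne fun j => -d j - r1 j + r2 j)
    (hh1 : h1 = Finset.univ.inf' hne fun j => d j + r1 j + r2 j)
    (hh2 : h2 = Finset.univ.inf' hne fun j => d j - r1 j + r2 j)
    (hfeas : max (max (g1 - h1) (g1 - h2 - 2 * t)) (max (g2 - h1 + 2 * s) (g2 - h2)) ≤ 0)
    (θ : ℝ)
    (hθ : θ = max
      (max (max ((p1 - q1) / 2) ((p1 - q2) / 2 - t)) (max ((p2 - q1) / 2 + s) ((p2 - q2) / 2)))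
      (max
        (max (max (p1 - h1) (p1 - h2 - 2 * t)) (max (p2 - h1 + 2 * s) (p2 - h2)))
        (max (max (g1 - q1) (g1 - q2 - 2 * t)) (max (g2 - q1 + 2 * s) (g2 - q2))))) :
    max g1 (p1 - θ) = min (min h1 (q1 + θ)) (min (h2 + 2 * t) (q2 + 2 * t + θ)) ∨
    max g2 (p2 - θ) = min (min (h1 - 2 * s) (q1 - 2 * s + θ)) (min h2 (q2 + θ)) := by
  clear hp1 hp2 hq1 hq2 hg1 hg2 hh1 hh2
  have hle := hθ.ge
  simp only [max_le_iff] at hle hfeas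
  obtain ⟨⟨⟨a1, a2⟩, a3, a4⟩, ⟨⟨b1, b2⟩, b3, b4⟩, ⟨c1, c2⟩, c3, c4⟩ := hle
  obtain ⟨⟨f1, f2⟩, f3, f4⟩ := hfeas
  have key1 : max g1 (p1 - θ) ≤ min (min h1 (q1 + θ)) (min (h2 + 2 * t) (q2 + 2 * t + θ)) := by
    simp only [max_le_iff, le_min_iff]
    refine ⟨⟨⟨?_, ?_⟩, ?_, ?_⟩, ⟨?_, ?_⟩, ?_, ?_⟩ <;> linarith
  have key2 : max g2 (p2 - θ) ≤
      min (min (h1 - 2 * s) (q1 - 2 * s + θ)) (min h2 (q2 + θ)) := by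
    simp only [max_le_iff, le_min_iff]
    refine ⟨⟨⟨?_, ?_⟩, ?_, ?_⟩, ⟨?_, ?_⟩, ?_, ?_⟩ <;> linarith
  have hcase : ∀ x y : ℝ, θ = max x y → θ = x ∨ θ = y := by
    intro x y h
    rcases max_choice x y with e | e
    · exact Or.inl (h.trans e)
    · exact Or.inr (h.trans e)
  suffices hs : min (min h1 (q1 + θ)) (min (h2 + 2 * t) (q2 + 2 * t + θ)) ≤ max g1 (p1 - θ) ∨
      min (min (h1 - 2 * s) (q1 - 2 * s + θ)) (min h2 (q2 + θ)) ≤ max g2 (p2 - θ) from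
    hs.imp (le_antisymm key1) (le_antisymm key2)
  simp only [min_le_iff, le_max_iff]
  by_contra hcon
  simp only [not_or, not_le] at hcon
  obtain ⟨⟨⟨⟨u1, u2⟩, u3, u4⟩, ⟨u5, u6⟩, u7, u8⟩, ⟨⟨v1, v2⟩, v3, v4⟩, ⟨v5, v6⟩, v7, v8⟩ := hcon
  rcases hcase _ _ hθ with h | h <;> rcases hcase _ _ h with h | h <;>
    rcases hcase _ _ h with h | h <;> first
    | linarith
    | (rcases hcase _ _ h with h | h <;> linarith)
end

section
/- Define θ = (1/2)·max( p1 − q1, p2 − q2 ). Then a point (x1, x2) ∈ ℝ² attains max_j ( w_j + |x1 − r_{1j}| + |x2 − r_{2j}| ) = θ if and only if there exists α ∈ [0,1] such that x1 = (1−α)·(p1 − p2)/2 + α·(q1 − q2)/2 and x2 = (2α − 1)·θ + (1−α)·(p1 + p2)/2 + α·(q1 + q2)/2. -/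
theorem aux_interval (a b t : ℝ) (h1 : a ≤ t) (h2 : t ≤ b) :
    ∃ α : ℝ, 0 ≤ α ∧ α ≤ 1 ∧ t = (1 - α) * a + α * b := by
  rcases eq_or_lt_of_le (h1.trans h2) with h | h
  · exact ⟨0, le_rfl, zero_le_one, by linarith⟩
  · have hL : 0 < b - a := by linarith
    refine ⟨(t - a) / (b - a), div_nonneg (by linarith) hL.le,
      (div_le_one hL).2 (by linarith), ?_⟩
    field_simp
    ring

theorem stmt19 (m : ℕ) (hm : 1 ≤ m)
    (hne : (Finset.univ : Finset (Fin m)).Nonempty)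
    (r1 r2 w : Fin m → ℝ)
    (p1 p2 q1 q2 : ℝ)
    (hp1 : p1 = Finset.univ.sup' hne fun j => w j + r1 j + r2 j)
    (hp2 : p2 = Finset.univ.sup' hne fun j => w j - r1 j + r2 j)
    (hq1 : q1 = Finset.univ.inf' hne fun j => -w j + r1 j + r2 j)
    (hq2 : q2 = Finset.univ.inf' hne fun j => -w j - r1 j + r2 j)
    (θ : ℝ)
    (hθ : θ = (1 / 2) * max (p1 - q1) (p2 - q2)) :
    ∀ x1 x2 : ℝ,
      (Finset.univ.sup' hne fun j => w j + |x1 - r1 j| + |x2 - r2 j|) = θ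
      ↔
      (∃ α : ℝ, 0 ≤ α ∧ α ≤ 1 ∧
        x1 = (1 - α) * ((p1 - p2) / 2) + α * ((q1 - q2) / 2) ∧
        x2 = (2 * α - 1) * θ + (1 - α) * ((p1 + p2) / 2) + α * ((q1 + q2) / 2)) := by
  intro x1 x2
  have key : ∀ c : ℝ, (Finset.univ.sup' hne fun j => w j + |x1 - r1 j| + |x2 - r2 j|) ≤ c ↔
      (p1 ≤ c + (x1 + x2) ∧ p2 ≤ c + (x2 - x1) ∧ x1 + x2 - c ≤ q1 ∧ x2 - x1 - c ≤ q2) := by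
    intro c
    rw [hp1, hp2, hq1, hq2]
    simp only [Finset.sup'_le_iff, Finset.le_inf'_iff, Finset.mem_univ, true_imp_iff,
      ← forall_and]
    refine forall_congr' fun j => ?_
    constructor
    · intro h
      have a1 := le_abs_self (x1 - r1 j)
      have a2 := neg_abs_le (x1 - r1 j)
      have a3 := le_abs_self (x2 - r2 j)
      have a4 := neg_abs_le (x2 - r2 j)
      refine ⟨?_, ?_, ?_, ?_⟩ <;> linarith
    · rintro ⟨h1, h2, h3, h4⟩
      rcases abs_cases (x1 - r1 j) with ⟨e, _⟩ | ⟨e, _⟩ <;>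
      rcases abs_cases (x2 - r2 j) with ⟨e', _⟩ | ⟨e', _⟩ <;>
      rw [e, e'] <;> linarith
  have m1 : p1 - q1 ≤ 2 * θ := by
    have := le_max_left (p1 - q1) (p2 - q2)
    linarith
  have m2 : p2 - q2 ≤ 2 * θ := by
    have := le_max_right (p1 - q1) (p2 - q2)
    linarith
  constructor
  · intro h
    obtain ⟨h1, h2, h3, h4⟩ := (key θ).1 h.le
    rcases max_choice (p1 - q1) (p2 - q2) with e | e
    · rw [e] at hθ
      obtain ⟨α, k0, k1, k⟩ := aux_interval (p2 - θ) (q2 + θ) (x2 - x1)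
        (by linarith) (by linarith)
      have hq : q1 = p1 - 2 * θ := by linarith
      have hs : x1 + x2 = p1 - θ := by linarith
      subst hq
      exact ⟨α, k0, k1, by linarith, by linarith⟩
    · rw [e] at hθ
      obtain ⟨α, k0, k1, k⟩ := aux_interval (p1 - θ) (q1 + θ) (x1 + x2)
        (by linarith) (by linarith)
      have hq : q2 = p2 - 2 * θ := by linarith
      have hs : x2 - x1 = p2 - θ := by linarith
      subst hq
      exact ⟨α, k0, k1, by linarith, by linarith⟩
  · rintro ⟨α, k0, k1, e1, e2⟩
    apply le_antisymm
    · rw [key]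
      have u1 := mul_nonneg k0 (sub_nonneg.2 m1)
      have u2 := mul_nonneg k0 (sub_nonneg.2 m2)
      have v1 := mul_nonneg (sub_nonneg.2 k1) (sub_nonneg.2 m1)
      have v2 := mul_nonneg (sub_nonneg.2 k1) (sub_nonneg.2 m2)
      refine ⟨?_, ?_, ?_, ?_⟩ <;> rw [e1, e2] <;> linarith
    · obtain ⟨h1, h2, h3, h4⟩ := (key _).1 le_rfl
      rcases max_choice (p1 - q1) (p2 - q2) with e | e <;> rw [e] at hθ <;> linarith
end
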